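/- arXiv:2302.07312 — 2 statements merged into one kernel-verified Lean document; each statement's English description precedes it below -/
import Mathlib

section
/- Let q_1, q_2 be real numbers with q_1, q_2 > 1, q_1 < 2 and q_1 q_2 ((q_2 − 2) + q_2(q_1 − 2)) < 1. Let (φ̄_1, φ̄_2) be a global spherically symmetric C² solution on [0,∞) × ℝ³ of the Glassey–Strauss system □φ̄_1 = |φ̄_2|^{q_1}, □φ̄_2 = |∂_tφ̄_1|^{q_2}, whose initial data are supported in the unit ball {|x| ≤ 1}. Then both φ̄_1 and φ̄_2 vanish at every point (t,x) with |x| ≥ 1 − t; in particular, the solution is supported in the backward light cone {(t,x) : |x| < 1 − t} and vanishes identically for t ≥ 1. -/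
open Real Set MeasureTheory

noncomputable section

/-- Three-dimensional Euclidean space. -/
abbrev E3 : Type := EuclideanSpace ℝ (Fin 3)

/-- Partial derivative in time of a function of `(t, x)`. -/
def dtP (φ : ℝ → E3 → ℝ) : ℝ → E3 → ℝ := fun t x => deriv (fun s => φ s x) t

/-- Partial derivative in the `i`-th spatial coordinate. -/
def pX (i : Fin 3) (f : E3 → ℝ) : E3 → ℝ :=
  fun x => deriv (fun h : ℝ => f (x + h • (EuclideanSpace.single i (1 : ℝ)))) 0

/-- Spatial Laplacian on `ℝ³`. -/
def lap3 (f : E3 → ℝ) : E3 → ℝ := fun x => ∑ i : Fin 3, pX i (pX i f) x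

/-- The wave operator `□φ = ∂_t²φ - Δφ` on `ℝ^{1+3}`. -/
def box (φ : ℝ → E3 → ℝ) : ℝ → E3 → ℝ := fun t x => dtP (dtP φ) t x - lap3 (φ t) x

/-- A function on `ℝ³` is radial (spherically symmetric) if it depends only on `|x|`. -/
def Radial (f : E3 → ℝ) : Prop := ∀ x y : E3, ‖x‖ = ‖y‖ → f x = f y

/-- `C²` data of a radial wave in null coordinates `u = t - r`, `v = t + r`: `Ψ` is `r φ`, `A` and
`B` are its derivatives in `v` and `u`, and `G ≥ 0` is the source `∂ᵤ∂ᵥΨ`. The initial data vanish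
for `r ≥ 1`. -/
structure NullWave (Ψ A B G : ℝ → ℝ → ℝ) : Prop where
  cont : Continuous fun p : ℝ × ℝ => Ψ p.1 p.2
  cont_A : Continuous fun p : ℝ × ℝ => A p.1 p.2
  cont_B : Continuous fun p : ℝ × ℝ => B p.1 p.2
  deriv_v : ∀ u v, HasDerivAt (fun y => Ψ u y) (A u v) v
  deriv_u : ∀ u v, HasDerivAt (fun x => Ψ x v) (B u v) u
  deriv_t : ∀ r u, HasDerivAt (fun x => Ψ x (x + 2 * r)) (A u (u + 2 * r) + B u (u + 2 * r)) u
  deriv_u_A : ∀ u v, -v ≤ u → u < v → HasDerivAt (fun x => A x v) (G u v) u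
  deriv_v_B : ∀ u v, -v ≤ u → u < v → HasDerivAt (fun y => B u y) (G u v) v
  source_nonneg : ∀ u v, u ≤ v → 0 ≤ G u v
  axis : ∀ u, Ψ u u = 0
  data : ∀ v, 1 ≤ v → Ψ (-v) v = 0 ∧ A (-v) v = 0 ∧ B (-v) v = 0

lemma mul_sub_le_of_hasDerivAt {f f' : ℝ → ℝ} {a b C : ℝ} (hab : a ≤ b) (hc : Continuous f)
    (hd : ∀ x ∈ Ioo a b, HasDerivAt f (f' x) x) (hC : ∀ x ∈ Ioo a b, C ≤ f' x) :
    C * (b - a) ≤ f b - f a := by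
  refine (convex_Icc a b).mul_sub_le_image_sub_of_le_deriv hc.continuousOn ?_ ?_ a
    (left_mem_Icc.2 hab) b (right_mem_Icc.2 hab) hab
  · rw [interior_Icc]
    exact fun x hx => (hd x hx).differentiableAt.differentiableWithinAt
  · rw [interior_Icc]
    intro x hx
    rw [(hd x hx).deriv]
    exact hC x hx

lemma abs_le_pow_div_factorial {f f' : ℝ → ℝ} {a b C L : ℝ} (n : ℕ) (hab : a ≤ b)
    (hc : Continuous f) (ha : f a = 0) (hd : ∀ x ∈ Ico a b, HasDerivAt f (f' x) x)
    (hb : ∀ x ∈ Ico a b, |f' x| ≤ L * (C * (L * (x - a)) ^ n / n.factorial)) :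
    |f b| ≤ C * (L * (b - a)) ^ (n + 1) / (n + 1).factorial := by
  have hB : ∀ x, HasDerivAt (fun x => C * (L * (x - a)) ^ (n + 1) / (n + 1).factorial)
      (L * (C * (L * (x - a)) ^ n / n.factorial)) x := by
    intro x
    have h := (((((hasDerivAt_id x).sub_const a).const_mul L).pow (n + 1)).const_mul C).div_const
      ((n + 1).factorial : ℝ)
    refine h.congr_deriv ?_
    rw [Nat.factorial_succ]
    push_cast
    have : (n.factorial : ℝ) ≠ 0 := by positivity
    simp only [id]
    field_simp
  have := image_norm_le_of_norm_deriv_right_le_deriv_boundary hc.continuousOn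
    (fun x hx => (hd x hx).hasDerivWithinAt) (by simp [ha]) hB hb (right_mem_Icc.2 hab)
  simpa using this

lemma tangent_le_abs_rpow {q a : ℝ} (hq : 1 ≤ q) (ha : 0 < a) (y : ℝ) :
    q * a ^ (q - 1) * y - (q - 1) * a ^ q ≤ |y| ^ q := by
  have h := one_add_mul_self_le_rpow_one_add (s := |y| / a - 1)
    (by have : 0 ≤ |y| / a := by positivity
        linarith) hq
  rw [add_sub_cancel, div_rpow (abs_nonneg _) ha.le, le_div_iff₀ (by positivity)] at h
  have e : a ^ q = a ^ (q - 1) * a := by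
    rw [← rpow_add_one ha.ne', sub_add_cancel]
  have h2 : q * a ^ (q - 1) * y ≤ q * a ^ (q - 1) * |y| := by
    gcongr
    exact le_abs_self y
  have h3 : (1 + q * (|y| / a - 1)) * a ^ q = q * a ^ (q - 1) * |y| - (q - 1) * a ^ q := by
    rw [e]
    field_simp
    ring
  linarith

namespace NullWave

variable {Ψ A B G : ℝ → ℝ → ℝ}

lemma continuous_A_left (h : NullWave Ψ A B G) (v : ℝ) : Continuous fun u => A u v :=
  h.cont_A.comp (by fun_prop : Continuous fun u : ℝ => (u, v))

lemma continuous_B_right (h : NullWave Ψ A B G) (u : ℝ) : Continuous fun v => B u v :=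
  h.cont_B.comp (by fun_prop : Continuous fun v : ℝ => (u, v))

lemma continuous_left (h : NullWave Ψ A B G) (v : ℝ) : Continuous fun u => Ψ u v :=
  h.cont.comp (by fun_prop : Continuous fun u : ℝ => (u, v))

lemma continuous_right (h : NullWave Ψ A B G) (u : ℝ) : Continuous fun v => Ψ u v :=
  h.cont.comp (by fun_prop : Continuous fun v : ℝ => (u, v))

lemma A_mono (h : NullWave Ψ A B G) {u u' v : ℝ} (hu : -v ≤ u) (huu : u ≤ u') (hv : u' ≤ v) :
    A u v ≤ A u' v := by
  have := mul_sub_le_of_hasDerivAt (C := 0) huu (h.continuous_A_left v)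
    (fun x hx => h.deriv_u_A x v (by linarith [hx.1]) (by linarith [hx.2]))
    (fun x hx => h.source_nonneg x v (by linarith [hx.2]))
  linarith

lemma B_mono (h : NullWave Ψ A B G) {u v v' : ℝ} (hu : -v ≤ u) (huv : u ≤ v) (hv : v ≤ v') :
    B u v ≤ B u v' := by
  have := mul_sub_le_of_hasDerivAt (C := 0) hv (h.continuous_B_right u)
    (fun x hx => h.deriv_v_B u x (by linarith [hx.1]) (by linarith [hx.1]))
    (fun x hx => h.source_nonneg u x (by linarith [hx.1]))
  linarith

lemma A_nonneg (h : NullWave Ψ A B G) {u v : ℝ} (hv : 1 ≤ v) (hu : -v ≤ u) (huv : u ≤ v) :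
    0 ≤ A u v := by
  have := h.A_mono (le_refl (-v)) hu huv
  rwa [(h.data v hv).2.1] at this

lemma mono_v (h : NullWave Ψ A B G) {u v v' : ℝ} (hv : 1 ≤ v) (hu : -v ≤ u) (huv : u ≤ v)
    (hvv : v ≤ v') : Ψ u v ≤ Ψ u v' := by
  have := mul_sub_le_of_hasDerivAt (C := 0) hvv (h.continuous_right u)
    (fun x _ => h.deriv_v u x)
    (fun x hx => h.A_nonneg (by linarith [hx.1]) (by linarith [hx.1]) (by linarith [hx.1]))
  linarith

lemma nonneg (h : NullWave Ψ A B G) {u v : ℝ} (hu : 1 ≤ u) (huv : u ≤ v) : 0 ≤ Ψ u v := by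
  have := h.mono_v hu (by linarith) le_rfl huv
  rwa [h.axis] at this

/-- If `A` is positive somewhere outside the backward cone then `Ψ` is bounded below on a strip
reaching null infinity. -/
lemma exists_strip (h : NullWave Ψ A B G) {a v : ℝ} (ha : 1 ≤ a) (hav : a < v)
    (hA : 0 < A a v) : ∃ b V c, a < b ∧ b ≤ V ∧ 0 < c ∧ ∀ u ∈ Icc a b, ∀ y, V ≤ y → c ≤ Ψ u y := by
  have hcont : Continuous fun y => A a y :=
    h.cont_A.comp (by fun_prop : Continuous fun y : ℝ => (a, y))
  have hev : ∀ᶠ y in nhds v, A a v / 2 < A a y :=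
    hcont.continuousAt.eventually (lt_mem_nhds (by linarith))
  obtain ⟨ε, hε, hball⟩ := Metric.eventually_nhds_iff.1 hev
  refine ⟨(a + v) / 2, v + ε / 2, A a v / 2 * (ε / 2), by linarith, by linarith, by positivity, ?_⟩
  intro u hu y hy
  have h1 := mul_sub_le_of_hasDerivAt (a := v) (b := v + ε / 2) (C := A a v / 2) (by linarith)
    (h.continuous_right u) (fun x _ => h.deriv_v u x) (fun x hx => by
      have e1 := hball (y := x) (by rw [Real.dist_eq, abs_lt]; constructor <;> linarith [hx.1, hx.2])
      exact e1.le.trans (h.A_mono (by linarith [hx.1]) hu.1 (by linarith [hx.1, hu.2])))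
  have h2 := h.nonneg (u := u) (v := v) (by linarith [hu.1]) (by linarith [hu.2])
  have h3 := h.mono_v (u := u) (v := v + ε / 2) (v' := y) (by linarith) (by linarith [hu.1])
    (by linarith [hu.2]) hy
  rw [add_sub_cancel_left] at h1
  linarith

end NullWave

/-- The Glassey–Strauss system for radial functions, in null coordinates. -/
structure NullSystem (q1 q2 : ℝ) (Ψ1 A1 B1 Ψ2 A2 B2 : ℝ → ℝ → ℝ) : Prop where
  fst : NullWave Ψ1 A1 B1 fun u v => (v - u) / 8 * |Ψ2 u v / ((v - u) / 2)| ^ q1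
  snd : NullWave Ψ2 A2 B2 fun u v => (v - u) / 8 * |(A1 u v + B1 u v) / ((v - u) / 2)| ^ q2

namespace NullSystem

variable {q1 q2 : ℝ} {Ψ1 A1 B1 Ψ2 A2 B2 : ℝ → ℝ → ℝ}

lemma abs_div_rpow_le {q C r y : ℝ} (hq : 1 ≤ q) (hr : 1 ≤ r) (hy : |y| ≤ C) :
    r * |y / r| ^ q ≤ C ^ (q - 1) * |y| := by
  have h0 : |y / r| = |y| / r := by rw [abs_div, abs_of_pos (by linarith : 0 < r)]
  rcases eq_or_ne y 0 with rfl | hy0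
  · simp [zero_rpow (by linarith : q ≠ 0)]
  have hy' : 0 < |y| := abs_pos.2 hy0
  have h1 : |y| / r ≤ C := (div_le_self hy'.le hr).trans hy
  have h2 : 0 < |y| / r := by positivity
  have h3 : (|y| / r) ^ q = (|y| / r) ^ (q - 1) * (|y| / r) := by
    rw [← rpow_add_one h2.ne', sub_add_cancel]
  rw [h0, h3]
  have h4 : (|y| / r) ^ (q - 1) ≤ C ^ (q - 1) := rpow_le_rpow h2.le h1 (by linarith)
  calc r * ((|y| / r) ^ (q - 1) * (|y| / r)) = (|y| / r) ^ (q - 1) * |y| := by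
        field_simp
    _ ≤ _ := by gcongr

/-- Finite speed of propagation. -/
lemma exterior_eq_zero (h : NullSystem q1 q2 Ψ1 A1 B1 Ψ2 A2 B2) (hq1 : 1 < q1) (hq2 : 1 < q2)
    {v : ℝ} (hv : 1 ≤ v) : Ψ1 (-1) v = 0 := by
  have hbd : ∀ f : ℝ → ℝ → ℝ, (Continuous fun p : ℝ × ℝ => f p.1 p.2) →
      ∃ C, ∀ x ∈ Icc (-v) (-1), ∀ y ∈ Icc 1 v, |f x y| ≤ C := by
    intro f hf
    obtain ⟨C, hC⟩ := (isCompact_Icc.prod isCompact_Icc).exists_bound_of_continuousOn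
      (s := Icc (-v) (-1) ×ˢ Icc (1:ℝ) v) hf.continuousOn
    exact ⟨C, fun x hx y hy => hC (x, y) ⟨hx, hy⟩⟩
  obtain ⟨c1, h1⟩ := hbd Ψ1 h.fst.cont
  obtain ⟨c2, h2⟩ := hbd A1 h.fst.cont_A
  obtain ⟨c3, h3⟩ := hbd B1 h.fst.cont_B
  obtain ⟨c4, h4⟩ := hbd Ψ2 h.snd.cont
  obtain ⟨c5, h5⟩ := hbd B2 h.snd.cont_B
  obtain ⟨C, hC1, hCc1, hCc2, hCc3, hCc4, hCc5⟩ :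
      ∃ C, 1 ≤ C ∧ c1 ≤ C ∧ c2 ≤ C ∧ c3 ≤ C ∧ c4 ≤ C ∧ c5 ≤ C :=
    ⟨max (max 1 c5) (max (max c1 c2) (max c3 c4)), by simp, by simp, by simp, by simp, by simp,
      by simp⟩
  obtain ⟨L, hL1, hLq1, hLq2⟩ : ∃ L, 1 ≤ L ∧ (2 * C) ^ (q1 - 1) ≤ L ∧ (2 * C) ^ (q2 - 1) ≤ L :=
    ⟨max 1 (max ((2 * C) ^ (q1 - 1)) ((2 * C) ^ (q2 - 1))), by simp, by simp, by simp⟩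
  have key : ∀ n : ℕ, ∀ x ∈ Icc (-v) (-1), ∀ y ∈ Icc 1 v, -y ≤ x →
      |Ψ1 x y| ≤ C * (L * (y + x)) ^ n / n.factorial ∧
      |A1 x y| ≤ C * (L * (y + x)) ^ n / n.factorial ∧
      |B1 x y| ≤ C * (L * (y + x)) ^ n / n.factorial ∧
      |Ψ2 x y| ≤ C * (L * (y + x)) ^ n / n.factorial ∧
      |B2 x y| ≤ C * (L * (y + x)) ^ n / n.factorial := by
    intro n
    induction n with
    | zero =>
      intro x hx y hy hxy
      simp only [pow_zero, mul_one, Nat.factorial_zero, Nat.cast_one, div_one]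
      exact ⟨(h1 x hx y hy).trans hCc1, (h2 x hx y hy).trans hCc2, (h3 x hx y hy).trans hCc3,
        (h4 x hx y hy).trans hCc4, (h5 x hx y hy).trans hCc5⟩
    | succ n ih =>
      have hG1 : ∀ x ∈ Icc (-v) (-1), ∀ y ∈ Icc 1 v, -y ≤ x →
          |(y - x) / 8 * (|Ψ2 x y / ((y - x) / 2)| ^ q1)| ≤
            L * (C * (L * (y + x)) ^ n / n.factorial) := by
        intro x hx y hy hxy
        have hr : 1 ≤ (y - x) / 2 := by linarith [hx.2, hy.1]
        rw [abs_of_nonneg (mul_nonneg (by linarith) (by positivity))]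
        have e1 := abs_div_rpow_le hq1.le hr (((h4 x hx y hy).trans hCc4).trans
          (by linarith : C ≤ 2 * C))
        have e2 := (ih x hx y hy hxy).2.2.2.1
        have e3 := mul_le_mul hLq1 e2 (abs_nonneg _) (by linarith)
        have e4 : 0 ≤ (2 * C) ^ (q1 - 1) * |Ψ2 x y| := by positivity
        linarith
      have hG2 : ∀ x ∈ Icc (-v) (-1), ∀ y ∈ Icc 1 v, -y ≤ x →
          |(y - x) / 8 * (|(A1 x y + B1 x y) / ((y - x) / 2)| ^ q2)| ≤
            L * (C * (L * (y + x)) ^ n / n.factorial) := by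
        intro x hx y hy hxy
        have hr : 1 ≤ (y - x) / 2 := by linarith [hx.2, hy.1]
        rw [abs_of_nonneg (mul_nonneg (by linarith) (by positivity))]
        have e0 := abs_add_le (A1 x y) (B1 x y)
        have e1 := abs_div_rpow_le (C := 2 * C) hq2.le hr (y := A1 x y + B1 x y)
          (by linarith [h2 x hx y hy, h3 x hx y hy])
        obtain ⟨-, e2, e2', -, -⟩ := ih x hx y hy hxy
        have e3 := mul_le_mul hLq2 ((e0.trans (add_le_add e2 e2'))) (abs_nonneg _) (by linarith)
        have e4 : 0 ≤ (2 * C) ^ (q2 - 1) * |A1 x y + B1 x y| := by positivity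
        linarith
      intro x hx y hy hxy
      have hy1 : 1 ≤ y := hy.1
      have hx1 : x ≤ -1 := hx.2
      have hpos : ∀ x' y', -y' ≤ x' → 0 ≤ C * (L * (y' + x')) ^ n / n.factorial := by
        intro x' y' hxy'
        have : 0 ≤ y' + x' := by linarith
        positivity
      have mem_x : ∀ x' ∈ Ico (-y) x, x' ∈ Icc (-v) (-1) := fun x' hx' =>
        ⟨by linarith [hx'.1, hy.2], by linarith [hx'.2]⟩
      have mem_y : ∀ y' ∈ Ico (-x) y, y' ∈ Icc 1 v := fun y' hy' =>
        ⟨by linarith [hy'.1], by linarith [hy'.2, hy.2]⟩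
      have along_u : ∀ f f' : ℝ → ℝ, Continuous f → f (-y) = 0 →
          (∀ x' ∈ Ico (-y) x, HasDerivAt f (f' x') x') →
          (∀ x' ∈ Ico (-y) x, |f' x'| ≤ L * (C * (L * (y + x')) ^ n / n.factorial)) →
          |f x| ≤ C * (L * (y + x)) ^ (n + 1) / (n + 1).factorial := by
        intro f f' hc h0 hd hb
        have := abs_le_pow_div_factorial (C := C) (L := L) n hxy hc h0 hd fun x' hx' => by
          rw [show x' - -y = y + x' by ring]
          exact hb x' hx'
        rwa [show x - -y = y + x by ring] at this
      have along_v : ∀ f f' : ℝ → ℝ, Continuous f → f (-x) = 0 →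
          (∀ y' ∈ Ico (-x) y, HasDerivAt f (f' y') y') →
          (∀ y' ∈ Ico (-x) y, |f' y'| ≤ L * (C * (L * (y' + x)) ^ n / n.factorial)) →
          |f y| ≤ C * (L * (y + x)) ^ (n + 1) / (n + 1).factorial := by
        intro f f' hc h0 hd hb
        have := abs_le_pow_div_factorial (C := C) (L := L) n (by linarith) hc h0 hd
          fun y' hy' => by
            rw [show y' - -x = y' + x by ring]
            exact hb y' hy'
        rwa [show y - -x = y + x by ring] at this
      have le_L : ∀ x' z, -y ≤ x' → z ≤ C * (L * (y + x')) ^ n / n.factorial →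
          z ≤ L * (C * (L * (y + x')) ^ n / n.factorial) := fun x' z hx' hz =>
        hz.trans (le_mul_of_one_le_left (hpos x' y hx') hL1)
      refine ⟨?_, ?_, ?_, ?_, ?_⟩
      · exact along_u _ _ (h.fst.continuous_left y) (h.fst.data y hy1).1
          (fun x' _ => h.fst.deriv_u x' y)
          (fun x' hx' => le_L x' _ hx'.1 (ih x' (mem_x x' hx') y hy hx'.1).2.2.1)
      · exact along_u _ _ (h.fst.continuous_A_left y) (h.fst.data y hy1).2.1
          (fun x' hx' => h.fst.deriv_u_A x' y hx'.1 (by linarith [hx'.2]))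
          (fun x' hx' => hG1 x' (mem_x x' hx') y hy hx'.1)
      · have h0 := (h.fst.data (-x) (by linarith)).2.2
        rw [neg_neg] at h0
        exact along_v _ _ (h.fst.continuous_B_right x) h0
          (fun y' hy' => h.fst.deriv_v_B x y' (by linarith [hy'.1]) (by linarith [hy'.1]))
          (fun y' hy' => hG1 x hx y' (mem_y y' hy') (by linarith [hy'.1]))
      · exact along_u _ _ (h.snd.continuous_left y) (h.snd.data y hy1).1
          (fun x' _ => h.snd.deriv_u x' y)
          (fun x' hx' => le_L x' _ hx'.1 (ih x' (mem_x x' hx') y hy hx'.1).2.2.2.2)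
      · have h0 := (h.snd.data (-x) (by linarith)).2.2
        rw [neg_neg] at h0
        exact along_v _ _ (h.snd.continuous_B_right x) h0
          (fun y' hy' => h.snd.deriv_v_B x y' (by linarith [hy'.1]) (by linarith [hy'.1]))
          (fun y' hy' => hG2 x hx y' (mem_y y' hy') (by linarith [hy'.1]))
  have hlim : Filter.Tendsto (fun n : ℕ => C * ((L * (v + -1)) ^ n / n.factorial))
      Filter.atTop (nhds (C * 0)) :=
    (FloorSemiring.tendsto_pow_div_factorial_atTop _).const_mul C
  have := ge_of_tendsto' hlim fun n => by
    have := (key n (-1) ⟨by linarith, le_rfl⟩ v ⟨hv, le_rfl⟩ (by linarith)).1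
    rwa [mul_div_assoc] at this
  rw [mul_zero] at this
  exact abs_nonpos_iff.1 this

end NullSystem

namespace NullSystem

variable {q1 q2 : ℝ} {Ψ1 A1 B1 Ψ2 A2 B2 : ℝ → ℝ → ℝ}

lemma rpow_mul_le_mul_abs_div {q r R M z : ℝ} (hq : 1 ≤ q) (hr : 0 < r) (hR : r ≤ R) (hM : 0 ≤ M)
    (hz : M ≤ |z| ^ q) : R ^ (1 - q) * M ≤ r * |z / r| ^ q := by
  have h1 : R ^ (1 - q) ≤ r ^ (1 - q) := rpow_le_rpow_of_nonpos hr hR (by linarith)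
  have h2 : r * |z / r| ^ q = r ^ (1 - q) * |z| ^ q := by
    rw [abs_div, abs_of_pos hr, div_rpow (abs_nonneg _) hr.le, rpow_sub hr, rpow_one]
    ring
  rw [h2]
  gcongr

/-- A lower bound for `Ψ2` on a rectangle propagates to `Ψ1`. -/
lemma fst_lower (h : NullSystem q1 q2 Ψ1 A1 B1 Ψ2 A2 B2) (hq1 : 1 < q1) {u0 u1 u v1 v M : ℝ}
    (hu0 : 1 ≤ u0) (hu01 : u0 ≤ u1) (hu1 : u1 ≤ u) (huv : u ≤ v1) (hv : v1 ≤ v)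
    (hM : 0 ≤ M) (hlow : ∀ x ∈ Icc u0 u1, ∀ y ∈ Icc v1 v, M ≤ Ψ2 x y) :
    1 / 4 * (u1 - u0) * (v - v1) * (v / 2) ^ (1 - q1) * M ^ q1 ≤ Ψ1 u v := by
  have hA : ∀ y ∈ Ioo v1 v, 1 / 4 * ((v / 2) ^ (1 - q1) * M ^ q1) * (u1 - u0) ≤ A1 u y := by
    intro y hy
    have h1 := mul_sub_le_of_hasDerivAt (C := 1 / 4 * ((v / 2) ^ (1 - q1) * M ^ q1)) hu01
      (h.fst.continuous_A_left y)
      (fun x hx => h.fst.deriv_u_A x y (by linarith [hx.1, hy.1]) (by linarith [hx.2, hy.1]))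
      (fun x hx => by
        have := rpow_mul_le_mul_abs_div (r := (y - x) / 2) (R := v / 2) (z := Ψ2 x y) hq1.le
          (by linarith [hx.2, hy.1]) (by linarith [hx.1, hy.2]) (rpow_nonneg hM q1)
          (rpow_le_rpow hM ((hlow x ⟨hx.1.le, hx.2.le⟩ y ⟨hy.1.le, hy.2.le⟩).trans (le_abs_self _))
            (by linarith))
        linarith)
    have h2 := h.fst.A_nonneg (u := u0) (v := y) (by linarith [hy.1]) (by linarith [hy.1])
      (by linarith [hy.1])
    have h3 := h.fst.A_mono (v := y) (u := u1) (u' := u) (by linarith [hy.1]) hu1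
      (by linarith [hy.1])
    linarith
  have h1 := mul_sub_le_of_hasDerivAt hv (h.fst.continuous_right u)
    (fun y _ => h.fst.deriv_v u y) hA
  have h2 := h.fst.nonneg (u := u) (v := v1) (by linarith) huv
  linarith

/-- A lower bound for `Ψ1` on a segment of an outgoing null ray propagates to `Ψ2`: integrate
`∂ₜΨ1` along the lines of constant radius, starting from the exterior region. -/
lemma snd_lower (h : NullSystem q1 q2 Ψ1 A1 B1 Ψ2 A2 B2) (hq1 : 1 < q1) (hq2 : 1 < q2)
    {w u v1 v N : ℝ} (hw : 0 ≤ w) (hwu : w ≤ u) (hu : 1 ≤ u) (huv : w + u + 2 ≤ v1)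
    (hv : v1 ≤ v) (hN : 0 < N) (hlow : ∀ y ∈ Icc v1 v, N ≤ Ψ1 w y) :
    1 / 4 * (v - v1) * (v / 2) ^ (1 - q2) * (w + 1) ^ (1 - q2) * N ^ q2 ≤ Ψ2 u v := by
  obtain ⟨R1, hR1⟩ : ∃ R1, R1 = (v1 - w) / 2 := ⟨_, rfl⟩
  obtain ⟨R2, hR2⟩ : ∃ R2, R2 = (v - w) / 2 := ⟨_, rfl⟩
  obtain ⟨vb, hvb⟩ : ∃ vb, vb = v1 - w - 1 := ⟨_, rfl⟩
  obtain ⟨a, ha⟩ : ∃ a, a = N / (w + 1) := ⟨_, rfl⟩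
  have ha0 : 0 < a := by rw [ha]; positivity
  obtain ⟨κ, hκ⟩ : ∃ κ, κ = 1 / 2 * R2 ^ (1 - q2) := ⟨_, rfl⟩
  have hR12 : R1 ≤ R2 := by linarith
  have hR2pos : 0 < R2 := by linarith
  have hκ0 : 0 ≤ κ := by rw [hκ]; positivity
  let T : ℝ → ℝ → ℝ := fun x y => A1 x y + B1 x y
  let f : ℝ → ℝ → ℝ := fun x r => κ * (q2 * a ^ (q2 - 1) * T x (x + 2 * r) - (q2 - 1) * a ^ q2)
  have hT : Continuous fun p : ℝ × ℝ => T p.1 (p.1 + 2 * p.2) :=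
    (h.fst.cont_A.add h.fst.cont_B).comp
      (by fun_prop : Continuous fun p : ℝ × ℝ => (p.1, p.1 + 2 * p.2))
  have hf : Continuous (Function.uncurry f) :=
    continuous_const.mul ((continuous_const.mul hT).sub continuous_const)
  have inner : ∀ x ∈ Ioo (-1) w, (∫ r in R1..R2, f x r) ≤ B2 x v - B2 x vb := by
    intro x hx
    have hder : ∀ r ∈ Ioo R1 R2, HasDerivAt (fun r => B2 x (x + 2 * r))
        (((x + 2 * r) - x) / 8 *
          |(A1 x (x + 2 * r) + B1 x (x + 2 * r)) / (((x + 2 * r) - x) / 2)| ^ q2 * 2) r := by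
      intro r hr
      have h1 := h.snd.deriv_v_B x (x + 2 * r) (by linarith [hr.1, hx.1]) (by linarith [hr.1])
      have h2 : HasDerivAt (fun r : ℝ => x + 2 * r) 2 r := by
        simpa using ((hasDerivAt_id r).const_mul 2).const_add x
      exact h1.comp r h2
    have h1 := intervalIntegral.integral_le_sub_of_hasDeriv_right_of_le (φ := f x) hR12
      ((h.snd.continuous_B_right x).comp (by fun_prop : Continuous fun r : ℝ => x + 2 * r)
        |>.continuousOn)
      (fun r hr => (hder r hr).hasDerivWithinAt)
      ((hf.comp (by fun_prop : Continuous fun r : ℝ => (x, r))).continuousOn.integrableOn_Icc)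
      (fun r hr => by
        have hr0 : 0 < r := by linarith [hr.1]
        have e1 := tangent_le_abs_rpow hq2.le ha0 (T x (x + 2 * r))
        have e2 := rpow_mul_le_mul_abs_div (r := r) (R := R2) (z := T x (x + 2 * r)) hq2.le
          hr0 hr.2.le (by positivity) le_rfl
        have e3 := mul_le_mul_of_nonneg_left e1 hκ0
        have e4 : (x + 2 * r - x) / 2 = r := by ring
        have e5 : (x + 2 * r - x) / 8 = r / 4 := by ring
        rw [e4, e5]
        simp only [f, T] at *
        rw [hκ] at e3 ⊢
        linarith)
    simp only [Function.comp_def] at h1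
    have h2 := h.snd.B_mono (u := x) (v := x + 2 * R2) (v' := v) (by linarith [hx.1])
      (by linarith) (by linarith [hx.2])
    have h3 := h.snd.B_mono (u := x) (v := vb) (v' := x + 2 * R1) (by linarith [hx.1])
      (by linarith [hx.2]) (by linarith [hx.1])
    linarith
  have outer : (∫ x in (-1)..w, ∫ r in R1..R2, f x r) ≤
      (Ψ2 w v - Ψ2 w vb) - (Ψ2 (-1) v - Ψ2 (-1) vb) :=
    intervalIntegral.integral_le_sub_of_hasDeriv_right_of_le (by linarith)
      ((h.snd.continuous_left v).sub (h.snd.continuous_left vb)).continuousOn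
      (fun x _ => ((h.snd.deriv_u x v).sub (h.snd.deriv_u x vb)).hasDerivWithinAt)
      (intervalIntegral.continuous_parametric_intervalIntegral_of_continuous' hf R1 R2
        |>.continuousOn.integrableOn_Icc)
      inner
  rw [intervalIntegral_intervalIntegral_swap] at outer
  swap
  · exact (hf.continuousOn.integrableOn_compact (isCompact_uIcc.prod isCompact_uIcc)).mono_set
      (prod_mono uIoc_subset_uIcc uIoc_subset_uIcc)
  have line : ∀ r ∈ Icc R1 R2, κ * a ^ q2 * (w + 1) ≤ ∫ x in (-1)..w, f x r := by
    intro r hr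
    have hTr : Continuous fun x => T x (x + 2 * r) :=
      hT.comp (by fun_prop : Continuous fun x : ℝ => (x, r))
    have h1 : (∫ x in (-1)..w, T x (x + 2 * r)) = Ψ1 w (w + 2 * r) - Ψ1 (-1) (-1 + 2 * r) :=
      intervalIntegral.integral_eq_sub_of_hasDerivAt (fun x _ => h.fst.deriv_t r x)
        (hTr.intervalIntegrable _ _)
    have h2 : (∫ x in (-1)..w, f x r) = κ * (q2 * a ^ (q2 - 1) *
        (Ψ1 w (w + 2 * r) - Ψ1 (-1) (-1 + 2 * r)) - (w + 1) * ((q2 - 1) * a ^ q2)) := by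
      simp only [f]
      rw [intervalIntegral.integral_const_mul, intervalIntegral.integral_sub
        ((hTr.const_mul _).intervalIntegrable _ _) (by simp), intervalIntegral.integral_const_mul,
        h1]
      simp only [intervalIntegral.integral_const, smul_eq_mul, sub_neg_eq_add]
    rw [h2, h.exterior_eq_zero hq1 hq2 (by linarith [hr.1]), sub_zero, mul_assoc]
    refine mul_le_mul_of_nonneg_left ?_ hκ0
    have h3 := hlow (w + 2 * r) ⟨by linarith [hr.1], by linarith [hr.2]⟩
    have h4 : N = a * (w + 1) := by
      rw [ha]
      field_simp
    have h5 : a ^ q2 = a ^ (q2 - 1) * a := by rw [← rpow_add_one ha0.ne', sub_add_cancel]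
    have h6 : q2 * a ^ (q2 - 1) * (a * (w + 1)) ≤ q2 * a ^ (q2 - 1) * Ψ1 w (w + 2 * r) := by
      rw [← h4]
      gcongr
    rw [h5] at *
    linarith
  have lower : (R2 - R1) * (κ * a ^ q2 * (w + 1)) ≤ ∫ r in R1..R2, ∫ x in (-1)..w, f x r := by
    have hsw : Continuous (Function.uncurry fun r x => f x r) := hf.comp continuous_swap
    have := intervalIntegral.integral_mono_on hR12 (intervalIntegrable_const (μ := volume))
      (intervalIntegral.continuous_parametric_intervalIntegral_of_continuous' hsw (-1) w
        |>.intervalIntegrable R1 R2) line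
    rwa [intervalIntegral.integral_const, smul_eq_mul] at this
  have h1 := h.snd.mono_v (u := -1) (v := vb) (v' := v) (by linarith) (by linarith) (by linarith)
    (by linarith)
  have h2 := mul_sub_le_of_hasDerivAt (C := 0) hwu
    ((h.snd.continuous_left v).sub (h.snd.continuous_left vb))
    (fun x _ => (h.snd.deriv_u x v).sub (h.snd.deriv_u x vb))
    (fun x hx => sub_nonneg.2 (h.snd.B_mono (by linarith [hx.1]) (by linarith [hx.2])
      (by linarith)))
  simp only [Pi.sub_apply] at h2
  have h3 := h.snd.nonneg (u := u) (v := vb) hu (by linarith)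
  have h4 : 1 / 4 * (v - v1) * (v / 2) ^ (1 - q2) * (w + 1) ^ (1 - q2) * N ^ q2 ≤
      (R2 - R1) * (κ * a ^ q2 * (w + 1)) := by
    have e1 : (v / 2) ^ (1 - q2) ≤ R2 ^ (1 - q2) :=
      rpow_le_rpow_of_nonpos hR2pos (by linarith) (by linarith)
    have e2 : a ^ q2 * (w + 1) = (w + 1) ^ (1 - q2) * N ^ q2 := by
      rw [ha, div_rpow hN.le (by linarith), rpow_sub (by linarith), rpow_one]
      ring
    have e3 : (R2 - R1) * (κ * a ^ q2 * (w + 1)) =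
        1 / 4 * (v - v1) * R2 ^ (1 - q2) * (w + 1) ^ (1 - q2) * N ^ q2 := by
      rw [mul_assoc κ, e2, hκ, hR1, hR2]
      ring
    rw [e3]
    gcongr
  linarith

end NullSystem

namespace NullSystem

variable {q1 q2 : ℝ} {Ψ1 A1 B1 Ψ2 A2 B2 : ℝ → ℝ → ℝ}

/-- A lower bound for `Ψ2` on a strip improves to polynomial lower bounds far out. -/
lemma exists_rpow_lower (h : NullSystem q1 q2 Ψ1 A1 B1 Ψ2 A2 B2) (hq1 : 1 < q1) (hq2 : 1 < q2)
    (hq1' : q1 < 2) {a b V c : ℝ} (ha : 1 ≤ a) (hab : a < b) (hbV : b ≤ V) (hc : 0 < c)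
    (hstrip : ∀ u ∈ Icc a b, ∀ y, V ≤ y → c ≤ Ψ2 u y) :
    ∃ C U0, 0 < C ∧ 1 ≤ U0 ∧ ∀ u, U0 ≤ u → ∀ v, 4 * u ≤ v →
      C * u ^ (2 + q2 - q1 * q2) ≤ Ψ2 u v := by
  obtain ⟨c1, hc1⟩ : ∃ c1, c1 = 1 / 4 * (b - a) * c ^ q1 := ⟨_, rfl⟩
  have hba : 0 < b - a := sub_pos.2 hab
  have hc1pos : 0 < c1 := by rw [hc1]; positivity
  refine ⟨1 / 4 * 2 ^ (1 - q2) * (b + 1) ^ (1 - q2) * c1 ^ q2, V + b + 2, ?_, by linarith, ?_⟩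
  · have : 0 < b + 1 := by linarith
    positivity
  intro u hu v hv
  have hu0 : 0 < u := by linarith
  have h1 : ∀ y ∈ Icc (3 * u) (4 * u), c1 * u ^ (2 - q1) ≤ Ψ1 b y := by
    intro y hy
    have hy2 : u ≤ y / 2 := by linarith [hy.1]
    have e1 := h.fst_lower hq1 (u0 := a) (u1 := b) (u := b) (v1 := y / 2) (v := y) ha hab.le le_rfl
      (by linarith) (by linarith) hc.le
      (fun x hx z hz => hstrip x hx z (by linarith [hz.1]))
    have e2 : (y / 2) ^ (2 - q1) = (y / 2) * (y / 2) ^ (1 - q1) := by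
      rw [show 2 - q1 = 1 + (1 - q1) by ring, rpow_add (by linarith), rpow_one]
    have e3 : u ^ (2 - q1) ≤ (y / 2) ^ (2 - q1) := rpow_le_rpow hu0.le hy2 (by linarith)
    calc c1 * u ^ (2 - q1) ≤ c1 * (y / 2) ^ (2 - q1) := by gcongr
      _ = 1 / 4 * (b - a) * (y - y / 2) * (y / 2) ^ (1 - q1) * c ^ q1 := by
        rw [e2, hc1]; ring
      _ ≤ _ := e1
  have h2 := h.snd_lower hq1 hq2 (w := b) (u := u) (v1 := 3 * u) (v := 4 * u) (by linarith)
    (by linarith) (by linarith) (by linarith) (by linarith) (by positivity) h1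
  have h3 := h.snd.mono_v (u := u) (v := 4 * u) (v' := v) (by linarith) (by linarith)
    (by linarith) hv
  refine le_trans (le_of_eq ?_) (h2.trans h3)
  have e1 : u ^ (2 + q2 - q1 * q2) = u * u ^ (1 - q2) * u ^ ((2 - q1) * q2) := by
    rw [show 2 + q2 - q1 * q2 = 1 + (1 - q2) + (2 - q1) * q2 by ring, rpow_add hu0,
      rpow_add hu0, rpow_one]
  have e2 : (4 * u / 2) ^ (1 - q2) = 2 ^ (1 - q2) * u ^ (1 - q2) := by
    rw [show 4 * u / 2 = 2 * u by ring, mul_rpow (by norm_num) hu0.le]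
  rw [mul_rpow hc1pos.le (by positivity), ← rpow_mul hu0.le, e1, e2]
  ring

/-- One step of the iteration on a rectangle of size `U`, shrinking it by a factor `δ`. -/
lemma box_gain (h : NullSystem q1 q2 Ψ1 A1 B1 Ψ2 A2 B2) (hq1 : 1 < q1) (hq2 : 1 < q2)
    {U δ M : ℝ} (hU : 1 ≤ U) (hδ : 0 < δ) (hδ1 : δ ≤ 1) (hM : 0 < M)
    (hlow : ∀ x ∈ Icc (U * (2 - δ)) (2 * U), ∀ y ∈ Icc (8 * U * (2 - δ)) (16 * U), M ≤ Ψ2 x y) :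
    ∀ x ∈ Icc (U * (2 - δ / 2)) (2 * U), ∀ y ∈ Icc (8 * U * (2 - δ / 2)) (16 * U),
      1 / 2 * 8 ^ (2 - 2 * q2) * (1 / 4) ^ q2 * 8 ^ ((1 - q1) * q2) * δ ^ (1 + 2 * q2) *
        U ^ (3 + q2 - q1 * q2) * M ^ (q1 * q2) ≤ Ψ2 x y := by
  intro u hu v hv
  have hUδ : 0 < U * δ := by positivity
  have hUδ1 : U * δ ≤ U := mul_le_of_le_one_right (by linarith) hδ1
  obtain ⟨hu1, hu2⟩ := hu
  obtain ⟨hv1, hv2⟩ := hv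
  have h1 : ∀ y ∈ Icc (8 * U * (2 - 3 / 4 * δ)) v,
      1 / 4 * (U ^ (2 : ℝ) * δ ^ (2 : ℝ)) * (8 * U) ^ (1 - q1) * M ^ q1 ≤ Ψ1 u y := by
    intro y hy
    obtain ⟨hy1, hy2⟩ := hy
    have e1 := h.fst_lower hq1 (u0 := U * (2 - δ)) (u1 := u) (u := u) (v1 := 8 * U * (2 - δ))
      (v := y) (by linarith) (by linarith) le_rfl (by linarith) (by linarith) hM.le
      (fun x hx z hz => hlow x ⟨hx.1, by linarith [hx.2]⟩ z ⟨hz.1, by linarith [hz.2]⟩)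
    have e2 : (8 * U) ^ (1 - q1) ≤ (y / 2) ^ (1 - q1) :=
      rpow_le_rpow_of_nonpos (by linarith) (by linarith) (by linarith)
    have e3 : 1 / 4 * (U ^ (2 : ℝ) * δ ^ (2 : ℝ)) ≤
        1 / 4 * (u - U * (2 - δ)) * (y - 8 * U * (2 - δ)) := by
      rw [rpow_two, rpow_two]
      have f1 : U * δ / 2 ≤ u - U * (2 - δ) := by linarith
      have f2 : 2 * (U * δ) ≤ y - 8 * U * (2 - δ) := by linarith
      have := mul_le_mul f1 f2 (by linarith) (by linarith)
      linarith
    refine le_trans ?_ e1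
    gcongr
    exact le_trans (by positivity) e3
  have h2 := h.snd_lower hq1 hq2 (w := u) (u := u) (v1 := 8 * U * (2 - 3 / 4 * δ)) (v := v)
    (by linarith) le_rfl (by linarith) (by linarith) (by linarith) (by positivity) h1
  refine le_trans ?_ h2
  have hU0 : 0 < U := by linarith
  have e1 : (8 * U) ^ (1 - q2) ≤ (v / 2) ^ (1 - q2) :=
    rpow_le_rpow_of_nonpos (by linarith) (by linarith) (by linarith)
  have e2 : (8 * U) ^ (1 - q2) ≤ (u + 1) ^ (1 - q2) :=
    rpow_le_rpow_of_nonpos (by linarith) (by linarith) (by linarith)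
  have e3 : 1 / 2 * (U * δ) ≤ 1 / 4 * (v - 8 * U * (2 - 3 / 4 * δ)) := by linarith
  have e4 : 0 ≤ 1 / 4 * (v - 8 * U * (2 - 3 / 4 * δ)) := by linarith
  have e5 : 0 ≤ 1 / 4 * (v - 8 * U * (2 - 3 / 4 * δ)) * (v / 2) ^ (1 - q2) :=
    mul_nonneg e4 (rpow_nonneg (by linarith) _)
  have eN : (1 / 4 * (U ^ (2 : ℝ) * δ ^ (2 : ℝ)) * (8 * U) ^ (1 - q1) * M ^ q1) ^ q2 =
      (1 / 4) ^ q2 * (U ^ (2 * q2) * δ ^ (2 * q2)) *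
        (8 ^ ((1 - q1) * q2) * U ^ ((1 - q1) * q2)) * M ^ (q1 * q2) := by
    have p1 : (0:ℝ) ≤ U ^ (2 : ℝ) := by positivity
    have p2 : (0:ℝ) ≤ δ ^ (2 : ℝ) := by positivity
    have p3 : (0:ℝ) ≤ (8 * U) ^ (1 - q1) := by positivity
    have p4 : (0:ℝ) ≤ M ^ q1 := by positivity
    have p5 : (0:ℝ) ≤ 1 / 4 := by norm_num
    rw [mul_rpow (by positivity) p4, mul_rpow (by positivity) p3, mul_rpow p5 (by positivity),
      mul_rpow p1 p2, ← rpow_mul hM.le, ← rpow_mul (by positivity : 0 ≤ 8 * U),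
      mul_rpow (by norm_num : (0:ℝ) ≤ 8) hU0.le, ← rpow_mul hU0.le, ← rpow_mul hδ.le]
  calc _ = 1 / 2 * (U * δ) * (8 * U) ^ (1 - q2) * (8 * U) ^ (1 - q2) *
        (1 / 4 * (U ^ (2 : ℝ) * δ ^ (2 : ℝ)) * (8 * U) ^ (1 - q1) * M ^ q1) ^ q2 := by
        rw [eN, mul_rpow (by norm_num : (0:ℝ) ≤ 8) hU0.le,
          show 3 + q2 - q1 * q2 = 1 + (1 - q2) + (1 - q2) + 2 * q2 + (1 - q1) * q2 by ring,
          rpow_add hU0, rpow_add hU0, rpow_add hU0, rpow_add hU0, rpow_add hδ, rpow_one, rpow_one,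
          show (2 : ℝ) - 2 * q2 = (1 - q2) + (1 - q2) by ring, rpow_add (by norm_num : (0:ℝ) < 8)]
        ring
    _ ≤ _ := by gcongr

/-- Below the critical curve `Ψ2` cannot be bounded below on a strip. -/
lemma not_strip_snd (h : NullSystem q1 q2 Ψ1 A1 B1 Ψ2 A2 B2) (hq1 : 1 < q1) (hq2 : 1 < q2)
    (hq1' : q1 < 2) (hsub : q1 * q2 * ((q2 - 2) + q2 * (q1 - 2)) < 1) {a b V c : ℝ} (ha : 1 ≤ a)
    (hab : a < b) (hbV : b ≤ V) (hc : 0 < c)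
    (hstrip : ∀ u ∈ Icc a b, ∀ y, V ≤ y → c ≤ Ψ2 u y) : False := by
  obtain ⟨C, U0, hC, hU0, hlow⟩ := h.exists_rpow_lower hq1 hq2 hq1' ha hab hbV hc hstrip
  obtain ⟨p, hp⟩ : ∃ p, p = q1 * q2 := ⟨_, rfl⟩
  have hp1 : 1 < p := by rw [hp]; nlinarith
  obtain ⟨C', hC', hC'pos⟩ : ∃ C', C' = C * min 1 (2 ^ (2 + q2 - p)) ∧ 0 < C' :=
    ⟨_, rfl, by positivity⟩
  obtain ⟨κ, hκ, hκpos⟩ : ∃ κ : ℝ, κ = 1 / 2 * 8 ^ (2 - 2 * q2) * (1 / 4) ^ q2 *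
    8 ^ ((1 - q1) * q2) ∧ 0 < κ := ⟨_, rfl, by positivity⟩
  obtain ⟨Λ, hΛ, hΛ1⟩ : ∃ Λ : ℝ, Λ ^ (p - 1) = 2 ^ (1 + 2 * q2) ∧ 1 < Λ := by
    refine ⟨(2 ^ (1 + 2 * q2)) ^ (p - 1)⁻¹, ?_, ?_⟩
    · rw [← rpow_mul (by positivity), inv_mul_cancel₀ (by linarith), rpow_one]
    · exact one_lt_rpow (one_lt_rpow (by norm_num) (by linarith)) (inv_pos.2 (by linarith))
  have hexp : 0 < (3 + q2 - p) + (2 + q2 - p) * (p - 1) := by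
    rw [← hp] at hsub
    have : q2 * q1 = p := by rw [hp]; ring
    have h2 : (q2 - 2) + q2 * (q1 - 2) = p - q2 - 2 := by rw [← this]; ring
    rw [h2] at hsub
    linarith
  obtain ⟨U, hUU0, hU⟩ : ∃ U, U0 ≤ U ∧
      Λ / (κ * C' ^ (p - 1)) ≤ U ^ ((3 + q2 - p) + (2 + q2 - p) * (p - 1)) :=
    ((Filter.eventually_ge_atTop U0).and
      ((tendsto_rpow_atTop hexp).eventually_ge_atTop _)).exists
  have hU1 : 1 ≤ U := hU0.trans hUU0
  have hUpos : 0 < U := by linarith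
  obtain ⟨M, hM⟩ : ∃ M, M = C' * U ^ (2 + q2 - p) := ⟨_, rfl⟩
  have hMpos : 0 < M := by rw [hM]; positivity
  have hgain : Λ ≤ κ * U ^ (3 + q2 - p) * M ^ (p - 1) := by
    rw [div_le_iff₀ (by positivity), rpow_add hUpos, rpow_mul hUpos.le] at hU
    rw [hM, mul_rpow hC'pos.le (by positivity)]
    linarith
  have base : ∀ x ∈ Icc U (2 * U), ∀ y, 8 * U ≤ y → M ≤ Ψ2 x y := by
    intro x hx y hy
    have e1 := hlow x (hUU0.trans hx.1) y (by linarith [hx.2])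
    rw [← hp] at e1
    refine le_trans ?_ e1
    rw [hM, hC', mul_assoc]
    refine mul_le_mul_of_nonneg_left ?_ hC.le
    rcases le_total 0 (2 + q2 - p) with hs | hs
    · calc _ ≤ 1 * U ^ (2 + q2 - p) := by gcongr; exact min_le_left _ _
        _ ≤ _ := by rw [one_mul]; exact rpow_le_rpow hUpos.le hx.1 hs
    · calc _ ≤ 2 ^ (2 + q2 - p) * U ^ (2 + q2 - p) := by gcongr; exact min_le_right _ _
        _ = (2 * U) ^ (2 + q2 - p) := (mul_rpow (by norm_num) hUpos.le).symm
        _ ≤ _ := rpow_le_rpow_of_nonpos (by linarith [hx.1]) hx.2 hs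
  have iter : ∀ n : ℕ, ∀ x ∈ Icc (U * (2 - (1 / 2) ^ n)) (2 * U),
      ∀ y ∈ Icc (8 * U * (2 - (1 / 2) ^ n)) (16 * U), M * Λ ^ n ≤ Ψ2 x y := by
    intro n
    induction n with
    | zero =>
      intro x hx y hy
      rw [pow_zero, mul_one]
      exact base x ⟨by linarith [hx.1], hx.2⟩ y (by linarith [hy.1])
    | succ n ih =>
      intro x hx y hy
      have hδ : (0:ℝ) < (1 / 2) ^ n := by positivity
      have hΛn : 0 < Λ ^ n := by positivity
      have hMn : 0 < M * Λ ^ n := by positivity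
      have e1 := h.box_gain hq1 hq2 hU1 hδ (pow_le_one₀ (by norm_num) (by norm_num)) hMn ih x
        (by rw [pow_succ] at hx; convert hx using 3; ring) y
        (by rw [pow_succ] at hy; convert hy using 3; ring)
      refine le_trans ?_ e1
      rw [← hp, ← hκ]
      have e2 : ((1 / 2 : ℝ) ^ n) ^ (1 + 2 * q2) * (Λ ^ n) ^ (p - 1) = 1 := by
        rw [← rpow_natCast Λ, ← rpow_mul (by linarith), mul_comm (n : ℝ), rpow_mul (by linarith),
          hΛ, ← rpow_natCast, ← rpow_mul (by norm_num), ← rpow_mul (by norm_num),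
          mul_comm (n : ℝ), ← mul_rpow (by norm_num) (by norm_num)]
        norm_num
      have e3 : (M * Λ ^ n) ^ p = M * Λ ^ n * (M ^ (p - 1) * (Λ ^ n) ^ (p - 1)) := by
        rw [← mul_rpow hMpos.le hΛn.le, mul_comm (M * Λ ^ n), ← rpow_add_one hMn.ne',
          sub_add_cancel]
      calc M * Λ ^ (n + 1) = M * Λ ^ n * Λ * 1 := by ring
        _ ≤ M * Λ ^ n * (κ * U ^ (3 + q2 - p) * M ^ (p - 1)) * 1 := by gcongr
        _ = M * Λ ^ n * (κ * U ^ (3 + q2 - p) * M ^ (p - 1)) *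
            (((1 / 2 : ℝ) ^ n) ^ (1 + 2 * q2) * (Λ ^ n) ^ (p - 1)) := by rw [e2]
        _ = _ := by rw [e3]; ring
  obtain ⟨n, hn⟩ := ((tendsto_pow_atTop_atTop_of_one_lt hΛ1).eventually_gt_atTop
    (Ψ2 (2 * U) (16 * U) / M)).exists
  have hδ : (0:ℝ) < (1 / 2) ^ n := by positivity
  have h1 := iter n (2 * U) ⟨by nlinarith, le_rfl⟩ (16 * U) ⟨by nlinarith, le_rfl⟩
  rw [div_lt_iff₀ hMpos] at hn
  linarith

lemma not_strip_fst (h : NullSystem q1 q2 Ψ1 A1 B1 Ψ2 A2 B2) (hq1 : 1 < q1) (hq2 : 1 < q2)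
    (hq1' : q1 < 2) (hsub : q1 * q2 * ((q2 - 2) + q2 * (q1 - 2)) < 1) {a b V c : ℝ} (ha : 1 ≤ a)
    (hab : a < b) (hbV : b ≤ V) (hc : 0 < c)
    (hstrip : ∀ u ∈ Icc a b, ∀ y, V ≤ y → c ≤ Ψ1 u y) : False := by
  have hv : b + (b + 1) + 2 + V ≤ b + (b + 1) + 2 + V + 1 := by linarith
  have hb : 0 < b + 1 := by linarith
  refine h.not_strip_snd hq1 hq2 hq1' hsub (a := b) (b := b + 1)
    (V := b + (b + 1) + 2 + V + 1)
    (c := 1 / 4 * ((b + (b + 1) + 2 + V + 1) - (b + (b + 1) + 2 + V)) *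
      ((b + (b + 1) + 2 + V + 1) / 2) ^ (1 - q2) * (b + 1) ^ (1 - q2) * c ^ q2)
    (by linarith) (by linarith) (by linarith) ?_ ?_
  · rw [add_sub_cancel_left]
    have : 0 < b + (b + 1) + 2 + V + 1 := by linarith
    positivity
  · intro u hu y hy
    refine (h.snd_lower hq1 hq2 (w := b) (u := u) (by linarith) hu.1 (by linarith [hu.1])
      (by linarith [hu.2]) hv hc (fun z hz => hstrip b ⟨hab.le, le_rfl⟩ z (by linarith [hz.1]))).trans
      (h.snd.mono_v (by linarith) (by linarith [hu.1]) (by linarith [hu.2]) hy)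

/-- Without positivity of `A` near infinity a null wave has `A = 0` outside the backward cone. -/
lemma _root_.NullWave.A_eq_zero {Ψ A B G : ℝ → ℝ → ℝ} (h : NullWave Ψ A B G)
    (hns : ∀ a b V c, 1 ≤ a → a < b → b ≤ V → 0 < c →
      (∀ u ∈ Icc a b, ∀ y, V ≤ y → c ≤ Ψ u y) → False)
    {u v : ℝ} (hv : 1 < v) (hu : -v ≤ u) (huv : u < v) : A u v = 0 := by
  refine le_antisymm ?_ (h.A_nonneg hv.le hu huv.le)
  refine (h.A_mono hu (le_max_left u 1) (max_le huv.le hv.le)).trans ?_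
  by_contra! hpos
  obtain ⟨b, V, c, hab, hbV, hc, hst⟩ := h.exists_strip (le_max_right u 1) (max_lt huv hv) hpos
  exact hns _ b V c (le_max_right u 1) hab hbV hc hst

/-- If `A` vanishes then so does the source. -/
lemma _root_.NullWave.source_eq_zero {Ψ A B G : ℝ → ℝ → ℝ} (h : NullWave Ψ A B G)
    (hA : ∀ u v, 1 < v → -v ≤ u → u < v → A u v = 0)
    {u v : ℝ} (hv : 1 < v) (hu : -v < u) (huv : u < v) : G u v = 0 := by
  have h1 : (fun x => A x v) =ᶠ[nhds u] fun _ => 0 := by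
    filter_upwards [Ioo_mem_nhds hu huv] with x hx
    exact hA x v hv hx.1.le hx.2
  exact (h.deriv_u_A u v hu.le huv).unique ((hasDerivAt_const u (0 : ℝ)).congr_of_eventuallyEq h1)

theorem eq_zero (h : NullSystem q1 q2 Ψ1 A1 B1 Ψ2 A2 B2) (hq1 : 1 < q1) (hq2 : 1 < q2)
    (hq1' : q1 < 2) (hsub : q1 * q2 * ((q2 - 2) + q2 * (q1 - 2)) < 1) {u v : ℝ}
    (hv : 1 < v) (hu : -v < u) (huv : u < v) : Ψ1 u v = 0 ∧ Ψ2 u v = 0 := by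
  have hA1 : ∀ u v, 1 < v → -v ≤ u → u < v → A1 u v = 0 := fun u v hv hu huv =>
    h.fst.A_eq_zero (fun a b V c => h.not_strip_fst hq1 hq2 hq1' hsub) hv hu huv
  have hA2 : ∀ u v, 1 < v → -v ≤ u → u < v → A2 u v = 0 := fun u v hv hu huv =>
    h.snd.A_eq_zero (fun a b V c => h.not_strip_snd hq1 hq2 hq1' hsub) hv hu huv
  have zero_of : ∀ {q r z : ℝ}, 1 < q → 0 < r → r / 8 * |z / (r / 2)| ^ q = 0 → z = 0 := by
    intro q r z hq hr hz
    rcases mul_eq_zero.1 hz with h1 | h1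
    · linarith
    · rw [rpow_eq_zero (abs_nonneg _) (by linarith), abs_eq_zero, div_eq_zero_iff] at h1
      exact h1.resolve_right (by linarith)
  refine ⟨?_, zero_of hq1 (by linarith) (h.fst.source_eq_zero hA1 hv hu huv)⟩
  have hT : ∀ x y, 1 < y → -y < x → x < y → A1 x y + B1 x y = 0 := fun x y hy hx hxy =>
    zero_of hq2 (by linarith) (h.snd.source_eq_zero hA2 hy hx hxy)
  have h1 : Ψ1 u v = Ψ1 u (v + 2 + |u|) := by
    have e1 := mul_sub_le_of_hasDerivAt (C := 0) (by linarith [abs_nonneg u] : v ≤ v + 2 + |u|)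
      (h.fst.continuous_right u) (fun x _ => h.fst.deriv_v u x)
      (fun x hx => (hA1 u x (by linarith [hx.1]) (by linarith [hx.1]) (by linarith [hx.1])).ge)
    have e2 := mul_sub_le_of_hasDerivAt (C := 0) (by linarith [abs_nonneg u] : v ≤ v + 2 + |u|)
      (h.fst.continuous_right u).neg (fun x _ => (h.fst.deriv_v u x).neg)
      (fun x hx => by
        rw [hA1 u x (by linarith [hx.1]) (by linarith [hx.1]) (by linarith [hx.1]), neg_zero])
    simp only [Pi.neg_apply] at e2
    linarith
  obtain ⟨r, hr⟩ : ∃ r, r = (v + 2 + |u| - u) / 2 := ⟨_, rfl⟩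
  have hur := le_abs_self u
  have hru : -r < u := by linarith [neg_abs_le u]
  have hc : Continuous fun x => Ψ1 x (x + 2 * r) :=
    h.fst.cont.comp (by fun_prop : Continuous fun x : ℝ => (x, x + 2 * r))
  have hT' : ∀ x ∈ Ioo (-r) u, A1 x (x + 2 * r) + B1 x (x + 2 * r) = 0 := fun x hx =>
    hT x _ (by linarith [hx.1]) (by linarith [hx.1]) (by linarith)
  have e1 := mul_sub_le_of_hasDerivAt (C := 0) hru.le hc (fun x _ => h.fst.deriv_t r x)
    (fun x hx => (hT' x hx).ge)
  have e2 := mul_sub_le_of_hasDerivAt (C := 0) hru.le hc.neg (fun x _ => (h.fst.deriv_t r x).neg)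
    (fun x hx => by rw [hT' x hx, neg_zero])
  have e3 := (h.fst.data r (by linarith)).1
  rw [h1, show v + 2 + |u| = u + 2 * r by rw [hr]; ring]
  simp only [Pi.neg_apply] at e2
  rw [show -r + 2 * r = r by ring, e3] at e1 e2
  linarith

end NullSystem

section RadialWave

lemma hasDerivAt_comp_curve {E : Type*} [NormedAddCommGroup E] [NormedSpace ℝ E] {g : E → ℝ}
    (hg : ContDiff ℝ 2 g) {c : ℝ → E} {c' : E} {s : ℝ} (hc : HasDerivAt c c' s) :
    HasDerivAt (fun x => g (c x)) (fderiv ℝ g (c s) c') s :=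
  ((hg.differentiable (by norm_num)) (c s)).hasFDerivAt.comp_hasDerivAt s hc

lemma hasDerivAt_fderiv_comp_curve {E : Type*} [NormedAddCommGroup E] [NormedSpace ℝ E]
    {g : E → ℝ} (hg : ContDiff ℝ 2 g) {c w : ℝ → E} {c' w' : E} {s : ℝ} (hc : HasDerivAt c c' s)
    (hw : HasDerivAt w w' s) :
    HasDerivAt (fun x => fderiv ℝ g (c x) (w x))
      (fderiv ℝ (fderiv ℝ g) (c s) c' (w s) + fderiv ℝ g (c s) w') s := by
  have h1 : Differentiable ℝ (fderiv ℝ g) :=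
    (hg.fderiv_right (m := 1) (by norm_num)).differentiable (by norm_num)
  exact ((h1 (c s)).hasFDerivAt.comp_hasDerivAt s hc).clm_apply hw

variable {φ : ℝ → E3 → ℝ}

/-- The first coordinate vector. -/
def axisVec : E3 := EuclideanSpace.single 0 1

lemma norm_smul_axisVec (r : ℝ) : ‖r • axisVec‖ = |r| := by
  simp [axisVec, norm_smul]

lemma dtP_eq (hg : ContDiff ℝ 2 (fun p : ℝ × E3 => φ p.1 p.2)) (t : ℝ) (x : E3) :
    dtP φ t x = fderiv ℝ (fun p : ℝ × E3 => φ p.1 p.2) (t, x) (1, 0) :=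
  (hasDerivAt_comp_curve hg ((hasDerivAt_id t).prodMk (hasDerivAt_const t x))).deriv

lemma dtP_dtP_eq (hg : ContDiff ℝ 2 (fun p : ℝ × E3 => φ p.1 p.2)) (t : ℝ) (x : E3) :
    dtP (dtP φ) t x =
      fderiv ℝ (fderiv ℝ (fun p : ℝ × E3 => φ p.1 p.2)) (t, x) (1, 0) (1, 0) := by
  have h := hasDerivAt_fderiv_comp_curve hg ((hasDerivAt_id t).prodMk (hasDerivAt_const t x))
    (hasDerivAt_const t ((1 : ℝ), (0 : E3)))
  rw [map_zero, add_zero] at h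
  simp only [id, ← dtP_eq hg] at h
  exact h.deriv

lemma pX_eq (hg : ContDiff ℝ 2 (fun p : ℝ × E3 => φ p.1 p.2)) (i : Fin 3) (t : ℝ) (x : E3) :
    pX i (φ t) x = fderiv ℝ (fun p : ℝ × E3 => φ p.1 p.2) (t, x)
      (0, EuclideanSpace.single i 1) := by
  have h := hasDerivAt_comp_curve hg ((hasDerivAt_const (0 : ℝ) t).prodMk
    (((hasDerivAt_id (0 : ℝ)).smul_const (EuclideanSpace.single i (1 : ℝ) : E3)).const_add x))
  simp only [id, zero_smul, add_zero, one_smul] at h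
  exact h.deriv

lemma pX_pX_eq (hg : ContDiff ℝ 2 (fun p : ℝ × E3 => φ p.1 p.2)) (i : Fin 3) (t : ℝ) (x : E3) :
    pX i (pX i (φ t)) x = fderiv ℝ (fderiv ℝ (fun p : ℝ × E3 => φ p.1 p.2)) (t, x)
      (0, EuclideanSpace.single i 1) (0, EuclideanSpace.single i 1) := by
  have h := hasDerivAt_fderiv_comp_curve hg ((hasDerivAt_const (0 : ℝ) t).prodMk
    (((hasDerivAt_id (0 : ℝ)).smul_const (EuclideanSpace.single i (1 : ℝ) : E3)).const_add x))
    (hasDerivAt_const (0 : ℝ) ((0 : ℝ), (EuclideanSpace.single i 1 : E3)))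
  simp only [id, zero_smul, add_zero, one_smul, map_zero, ← pX_eq hg] at h
  exact h.deriv

/-- Second derivatives of a radial function in the angular directions. -/
lemma mul_fderiv_fderiv_angular (hg : ContDiff ℝ 2 (fun p : ℝ × E3 => φ p.1 p.2))
    (hrad : ∀ t, Radial (φ t)) {i : Fin 3} (hi : i ≠ 0) (t : ℝ) {r : ℝ} (hr : 0 < r) :
    r * fderiv ℝ (fderiv ℝ (fun p : ℝ × E3 => φ p.1 p.2)) (t, r • axisVec)
      (0, EuclideanSpace.single i 1) (0, EuclideanSpace.single i 1) =
      fderiv ℝ (fun p : ℝ × E3 => φ p.1 p.2) (t, r • axisVec) (0, axisVec) := by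
  obtain ⟨e, he⟩ : ∃ e : E3, e = EuclideanSpace.single i 1 := ⟨_, rfl⟩
  rw [← he]
  have hc : ∀ θ : ℝ, HasDerivAt (fun θ => (t, (r * cos θ) • axisVec + (r * sin θ) • e))
      (0, (r * -sin θ) • axisVec + (r * cos θ) • e) θ := fun θ =>
    (hasDerivAt_const θ t).prodMk ((((hasDerivAt_cos θ).const_mul r).smul_const axisVec).add
      (((hasDerivAt_sin θ).const_mul r).smul_const e))
  have hw : HasDerivAt (fun θ => ((0 : ℝ), (r * -sin θ) • axisVec + (r * cos θ) • e))
      (0, (r * -cos 0) • axisVec + (r * -sin 0) • e) 0 :=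
    (hasDerivAt_const 0 (0 : ℝ)).prodMk
      ((((hasDerivAt_sin 0).neg.const_mul r).smul_const axisVec).add
      (((hasDerivAt_cos 0).const_mul r).smul_const e))
  have hconst : ∀ θ : ℝ, φ t ((r * cos θ) • axisVec + (r * sin θ) • e) = φ t (r • axisVec) := by
    intro θ
    refine hrad t _ _ ?_
    have h0 : inner ℝ ((r * cos θ) • axisVec) ((r * sin θ) • e) = 0 := by
      rw [he, axisVec, inner_smul_left, inner_smul_right, EuclideanSpace.inner_single_left]
      simp [hi.symm]
    have h1 := norm_add_sq_eq_norm_sq_add_norm_sq_of_inner_eq_zero _ _ h0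
    have h2 : ‖(r * sin θ) • e‖ = |r * sin θ| := by simp [he, norm_smul]
    rw [norm_smul_axisVec, h2, abs_mul_abs_self, abs_mul_abs_self] at h1
    rw [norm_smul_axisVec, abs_of_pos hr]
    have h3 : ‖(r * cos θ) • axisVec + (r * sin θ) • e‖ ^ 2 = r ^ 2 := by
      rw [sq, h1]
      linear_combination r ^ 2 * cos_sq_add_sin_sq θ
    exact (sq_eq_sq₀ (norm_nonneg _) hr.le).1 h3
  have hzero : ∀ θ : ℝ, fderiv ℝ (fun p : ℝ × E3 => φ p.1 p.2)
      (t, (r * cos θ) • axisVec + (r * sin θ) • e)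
      (0, (r * -sin θ) • axisVec + (r * cos θ) • e) = 0 := by
    intro θ
    have h1 := hasDerivAt_comp_curve hg (hc θ)
    simp only [hconst] at h1
    exact h1.unique (hasDerivAt_const _ _)
  have h2 := hasDerivAt_fderiv_comp_curve hg (hc 0) hw
  simp only [hzero] at h2
  have h3 := h2.unique (hasDerivAt_const _ _)
  simp only [sin_zero, cos_zero, neg_zero, mul_zero, zero_smul, zero_add, add_zero, mul_one,
    mul_neg] at h3
  have h4 : ((0 : ℝ), r • e) = r • ((0 : ℝ), e) := by simp
  have h5 : ((0 : ℝ), (-r) • axisVec) = (-r) • ((0 : ℝ), axisVec) := by simp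
  rw [h4, h5] at h3
  simp only [map_smul, smul_apply, smul_eq_mul] at h3
  have h6 : r * (r * fderiv ℝ (fderiv ℝ (fun p : ℝ × E3 => φ p.1 p.2)) (t, r • axisVec)
      (0, e) (0, e) -
      fderiv ℝ (fun p : ℝ × E3 => φ p.1 p.2) (t, r • axisVec) (0, axisVec)) = 0 := by
    linear_combination h3
  linarith [(mul_eq_zero.1 h6).resolve_left hr.ne']

/-- The wave operator of a radial function on the first coordinate axis. -/
lemma mul_box_eq (hg : ContDiff ℝ 2 (fun p : ℝ × E3 => φ p.1 p.2))
    (hrad : ∀ t, Radial (φ t)) (t : ℝ) {r : ℝ} (hr : 0 < r) :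
    r * box φ t (r • axisVec) =
      r * fderiv ℝ (fderiv ℝ (fun p : ℝ × E3 => φ p.1 p.2)) (t, r • axisVec) (1, 0) (1, 0) -
      r * fderiv ℝ (fderiv ℝ (fun p : ℝ × E3 => φ p.1 p.2)) (t, r • axisVec)
        (0, axisVec) (0, axisVec) -
      2 * fderiv ℝ (fun p : ℝ × E3 => φ p.1 p.2) (t, r • axisVec) (0, axisVec) := by
  have h1 := mul_fderiv_fderiv_angular hg hrad (i := 1) (by decide) t hr
  have h2 := mul_fderiv_fderiv_angular hg hrad (i := 2) (by decide) t hr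
  simp only [box, lap3, Fin.sum_univ_three, dtP_dtP_eq hg, pX_pX_eq hg]
  rw [← axisVec]
  linear_combination -h1 - h2

/-- The point of `ℝ × E3` with null coordinates `u = t - r`, `v = t + r` on the first axis. -/
def nullPoint (u v : ℝ) : ℝ × E3 := ((u + v) / 2, ((v - u) / 2) • axisVec)

/-- `r φ` in null coordinates. -/
def waveNull (φ : ℝ → E3 → ℝ) (u v : ℝ) : ℝ :=
  (v - u) / 2 * φ ((u + v) / 2) (((v - u) / 2) • axisVec)

/-- The outgoing null derivative of `r φ`. -/
def waveNullV (φ : ℝ → E3 → ℝ) (u v : ℝ) : ℝ :=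
  1 / 2 * φ ((u + v) / 2) (((v - u) / 2) • axisVec) +
    (v - u) / 2 * fderiv ℝ (fun p : ℝ × E3 => φ p.1 p.2) (nullPoint u v)
      (1 / 2, (1 / 2 : ℝ) • axisVec)

/-- The ingoing null derivative of `r φ`. -/
def waveNullU (φ : ℝ → E3 → ℝ) (u v : ℝ) : ℝ :=
  -1 / 2 * φ ((u + v) / 2) (((v - u) / 2) • axisVec) +
    (v - u) / 2 * fderiv ℝ (fun p : ℝ × E3 => φ p.1 p.2) (nullPoint u v)
      (1 / 2, (-1 / 2 : ℝ) • axisVec)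

lemma hasDerivAt_nullPoint_left (u v : ℝ) :
    HasDerivAt (fun x => nullPoint x v) (1 / 2, (-1 / 2 : ℝ) • axisVec) u :=
  (((hasDerivAt_id u).add_const v).div_const 2).prodMk
    ((((hasDerivAt_id u).const_sub v).div_const 2).smul_const axisVec)

lemma hasDerivAt_nullPoint_right (u v : ℝ) :
    HasDerivAt (fun y => nullPoint u y) (1 / 2, (1 / 2 : ℝ) • axisVec) v :=
  (((hasDerivAt_id v).const_add u).div_const 2).prodMk
    ((((hasDerivAt_id v).sub_const u).div_const 2).smul_const axisVec)

lemma continuous_nullPoint : Continuous fun p : ℝ × ℝ => nullPoint p.1 p.2 := by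
  unfold nullPoint
  fun_prop

lemma waveNullV_add_waveNullU (hg : ContDiff ℝ 2 (fun p : ℝ × E3 => φ p.1 p.2)) (u v : ℝ) :
    waveNullV φ u v + waveNullU φ u v =
      (v - u) / 2 * dtP φ ((u + v) / 2) (((v - u) / 2) • axisVec) := by
  have h1 : ((1 : ℝ), (0 : E3)) =
      (1 / 2, (1 / 2 : ℝ) • axisVec) + (1 / 2, (-1 / 2 : ℝ) • axisVec) := by
    rw [Prod.mk_add_mk, ← add_smul]
    norm_num
  rw [dtP_eq hg, h1, map_add, waveNullV, waveNullU, nullPoint]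
  ring

theorem nullWave_of_radial (hg : ContDiff ℝ 2 (fun p : ℝ × E3 => φ p.1 p.2))
    (hrad : ∀ t, Radial (φ t)) {S : ℝ → E3 → ℝ} (hS : ∀ t x, 0 ≤ S t x)
    (heq : ∀ (t : ℝ) (x : E3), 0 ≤ t → box φ t x = S t x)
    (hsupp : ∀ x : E3, 1 < ‖x‖ → φ 0 x = 0 ∧ dtP φ 0 x = 0) :
    NullWave (waveNull φ) (waveNullV φ) (waveNullU φ)
      fun u v => (v - u) / 8 * S ((u + v) / 2) (((v - u) / 2) • axisVec) := by
  obtain ⟨g, hgdef⟩ : ∃ g : ℝ × E3 → ℝ, g = fun p => φ p.1 p.2 := ⟨_, rfl⟩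
  rw [← hgdef] at hg
  have hfd : Continuous (fderiv ℝ g) := hg.continuous_fderiv (by norm_num)
  have hΨ : ∀ u v, waveNull φ u v = (v - u) / 2 * g (nullPoint u v) := fun u v => by
    rw [hgdef]; rfl
  have hA : ∀ u v, waveNullV φ u v = 1 / 2 * g (nullPoint u v) +
      (v - u) / 2 * fderiv ℝ g (nullPoint u v) (1 / 2, (1 / 2 : ℝ) • axisVec) := fun u v => by
    rw [hgdef]; rfl
  have hB : ∀ u v, waveNullU φ u v = -1 / 2 * g (nullPoint u v) +
      (v - u) / 2 * fderiv ℝ g (nullPoint u v) (1 / 2, (-1 / 2 : ℝ) • axisVec) := fun u v => by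
    rw [hgdef]; rfl
  have hgc : Continuous fun p : ℝ × ℝ => g (nullPoint p.1 p.2) :=
    hg.continuous.comp continuous_nullPoint
  have hfc : ∀ w, Continuous fun p : ℝ × ℝ => fderiv ℝ g (nullPoint p.1 p.2) w := fun w =>
    (hfd.comp continuous_nullPoint).clm_apply continuous_const
  have cΨ : Continuous fun p : ℝ × ℝ => waveNull φ p.1 p.2 := by
    simp only [hΨ]
    exact ((continuous_snd.sub continuous_fst).div_const 2).mul hgc
  have cA : Continuous fun p : ℝ × ℝ => waveNullV φ p.1 p.2 := by
    simp only [hA]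
    exact (continuous_const.mul hgc).add
      (((continuous_snd.sub continuous_fst).div_const 2).mul (hfc _))
  have cB : Continuous fun p : ℝ × ℝ => waveNullU φ p.1 p.2 := by
    simp only [hB]
    exact (continuous_const.mul hgc).add
      (((continuous_snd.sub continuous_fst).div_const 2).mul (hfc _))
  have hG : ∀ u v, -v ≤ u → u < v →
      1 / 2 * fderiv ℝ g (nullPoint u v) (1 / 2, (-1 / 2 : ℝ) • axisVec) -
      1 / 2 * fderiv ℝ g (nullPoint u v) (1 / 2, (1 / 2 : ℝ) • axisVec) +
      (v - u) / 2 * fderiv ℝ (fderiv ℝ g) (nullPoint u v) (1 / 2, (-1 / 2 : ℝ) • axisVec)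
        (1 / 2, (1 / 2 : ℝ) • axisVec) =
      (v - u) / 8 * S ((u + v) / 2) (((v - u) / 2) • axisVec) := by
    intro u v hu huv
    have hsymm := (hg.contDiffAt (x := nullPoint u v)).isSymmSndFDerivAt (by simp)
    have h1 := mul_box_eq (φ := φ) (hgdef ▸ hg) hrad ((u + v) / 2) (r := (v - u) / 2)
      (by linarith)
    rw [heq _ _ (by linarith), ← hgdef, ← nullPoint] at h1
    have e1 : ((1 / 2 : ℝ), (1 / 2 : ℝ) • axisVec) =
        (1 / 2 : ℝ) • ((1 : ℝ), (0 : E3)) + (1 / 2 : ℝ) • ((0 : ℝ), axisVec) := by simp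
    have e2 : ((1 / 2 : ℝ), (-1 / 2 : ℝ) • axisVec) =
        (1 / 2 : ℝ) • ((1 : ℝ), (0 : E3)) + (-1 / 2 : ℝ) • ((0 : ℝ), axisVec) := by simp
    have h2 := hsymm.eq ((1 : ℝ), (0 : E3)) ((0 : ℝ), axisVec)
    rw [e1, e2]
    simp only [map_add, map_smul, add_apply, smul_apply,
      smul_eq_mul]
    linear_combination (-1 / 4) * h1 + (v - u) / 8 * h2
  refine ⟨cΨ, cA, cB, ?_, ?_, ?_, ?_, ?_, ?_, ?_, ?_⟩
  · intro u v
    have h1 := (((hasDerivAt_id v).sub_const u).div_const 2).mul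
      (hasDerivAt_comp_curve hg (hasDerivAt_nullPoint_right u v))
    simp only [hΨ]
    exact h1.congr_deriv (hA u v).symm
  · intro u v
    have h1 := (((hasDerivAt_id u).const_sub v).div_const 2).mul
      (hasDerivAt_comp_curve hg (hasDerivAt_nullPoint_left u v))
    simp only [hΨ]
    exact h1.congr_deriv (hB u v).symm
  · intro r u
    have hc : HasDerivAt (fun x => nullPoint x (x + 2 * r)) ((1 : ℝ), (0 : E3)) u := by
      have h1 : (fun x => nullPoint x (x + 2 * r)) = fun x => (x + r, r • axisVec) := by
        funext x
        rw [nullPoint]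
        congr 2 <;> ring
      rw [h1]
      exact ((hasDerivAt_id u).add_const r).prodMk (hasDerivAt_const u _)
    have h1 := (hasDerivAt_comp_curve hg hc).const_mul r
    have h2 := waveNullV_add_waveNullU (φ := φ) (hgdef ▸ hg) u (u + 2 * r)
    rw [dtP_eq (hgdef ▸ hg), ← hgdef, ← nullPoint] at h2
    rw [h2]
    simp only [hΨ, add_sub_cancel_left, mul_div_cancel_left₀ r (two_ne_zero' ℝ)]
    exact h1
  · intro u v hu huv
    have h1 := ((hasDerivAt_comp_curve hg (hasDerivAt_nullPoint_left u v)).const_mul (1 / 2)).add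
      ((((hasDerivAt_id u).const_sub v).div_const 2).mul
      (hasDerivAt_fderiv_comp_curve hg (hasDerivAt_nullPoint_left u v)
        (hasDerivAt_const u ((1 / 2 : ℝ), (1 / 2 : ℝ) • axisVec))))
    simp only [hA]
    refine h1.congr_deriv ?_
    rw [← hG u v hu huv, map_zero]
    simp only [id]
    ring
  · intro u v hu huv
    have h1 := ((hasDerivAt_comp_curve hg (hasDerivAt_nullPoint_right u v)).const_mul
      (-1 / 2)).add ((((hasDerivAt_id v).sub_const u).div_const 2).mul
      (hasDerivAt_fderiv_comp_curve hg (hasDerivAt_nullPoint_right u v)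
        (hasDerivAt_const v ((1 / 2 : ℝ), (-1 / 2 : ℝ) • axisVec))))
    simp only [hB]
    refine h1.congr_deriv ?_
    have hsymm := (hg.contDiffAt (x := nullPoint u v)).isSymmSndFDerivAt (by simp)
    rw [← hG u v hu huv, map_zero, hsymm.eq (1 / 2, (-1 / 2 : ℝ) • axisVec)]
    simp only [id]
    ring
  · intro u v huv
    exact mul_nonneg (by linarith) (hS _ _)
  · intro u
    simp [hΨ]
  · have hnp : ∀ v, nullPoint (-v) v = (0, v • axisVec) := fun v => by
      rw [nullPoint]
      congr 2 <;> ring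
    have hd : ∀ v ∈ Ioi (1 : ℝ), g (0, v • axisVec) = 0 ∧
        ∀ a b : ℝ, fderiv ℝ g (0, v • axisVec) (a, b • axisVec) = 0 := by
      intro v hv
      have hpos : (0 : ℝ) < v := lt_trans one_pos hv
      have hz : ∀ y : ℝ, 1 < y → g (0, y • axisVec) = 0 := fun y hy => by
        simp only [hgdef]
        exact (hsupp _ (by rwa [norm_smul_axisVec, abs_of_pos (by linarith)])).1
      refine ⟨hz v hv, fun a b => ?_⟩
      have h1 := hasDerivAt_comp_curve hg ((hasDerivAt_const v (0 : ℝ)).prodMk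
        ((hasDerivAt_id v).smul_const axisVec))
      have h2 : fderiv ℝ g (0, v • axisVec) (0, (1 : ℝ) • axisVec) = 0 := by
        refine h1.unique ((hasDerivAt_const v (0 : ℝ)).congr_of_eventuallyEq ?_)
        filter_upwards [Ioi_mem_nhds hv] with y hy
        exact hz y hy
      have h3 : fderiv ℝ g (0, v • axisVec) (1, 0) = 0 := by
        rw [hgdef, ← dtP_eq (hgdef ▸ hg)]
        exact (hsupp _ (by rwa [norm_smul_axisVec, abs_of_pos hpos])).2
      have h4 : (a, b • axisVec) = a • ((1 : ℝ), (0 : E3)) + b • ((0 : ℝ), (1 : ℝ) • axisVec) := by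
        simp
      rw [h4, map_add, map_smul, map_smul, h2, h3, smul_zero, smul_zero, add_zero]
    have hcl : ∀ {f : ℝ → ℝ → ℝ}, (Continuous fun p : ℝ × ℝ => f p.1 p.2) →
        (∀ v ∈ Ioi (1 : ℝ), f (-v) v = 0) → ∀ v, 1 ≤ v → f (-v) v = 0 := by
      intro f hf h0 v hv
      have h1 : EqOn (fun v => f (-v) v) (fun _ => 0) (closure (Ioi (1 : ℝ))) :=
        EqOn.closure h0 (hf.comp (by fun_prop : Continuous fun v : ℝ => (-v, v))) continuous_const
      rw [closure_Ioi] at h1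
      exact h1 hv
    intro v hv
    refine ⟨hcl cΨ (fun y hy => ?_) v hv, hcl cA (fun y hy => ?_) v hv,
      hcl cB (fun y hy => ?_) v hv⟩
    · rw [hΨ, hnp, (hd y hy).1, mul_zero]
    · rw [hA, hnp, (hd y hy).1, (hd y hy).2, mul_zero, mul_zero, add_zero]
    · rw [hB, hnp, (hd y hy).1, (hd y hy).2, mul_zero, mul_zero, add_zero]

/-- A radial function that vanishes on the first axis outside the backward cone vanishes there
everywhere. -/
lemma eq_zero_of_waveNull_eq_zero (hg : ContDiff ℝ 2 (fun p : ℝ × E3 => φ p.1 p.2))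
    (hrad : ∀ t, Radial (φ t))
    (h0 : ∀ u v, 1 < v → -v < u → u < v → waveNull φ u v = 0) {t : ℝ} {x : E3} (ht : 0 ≤ t)
    (hx : 1 - t ≤ ‖x‖) : φ t x = 0 := by
  have h1 : EqOn (fun ε => φ (t + ε) ((‖x‖ + ε) • axisVec)) (fun _ => 0)
      (closure (Ioi (0 : ℝ))) := by
    refine EqOn.closure ?_ (hg.continuous.comp
      (by fun_prop : Continuous fun ε : ℝ => (t + ε, (‖x‖ + ε) • axisVec))) continuous_const
    intro ε hε
    have hε' : 0 < ε := hε
    have h2 := h0 (t - ‖x‖) (t + ‖x‖ + 2 * ε) (by linarith) (by linarith)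
      (by linarith [norm_nonneg x])
    rw [waveNull, show t - ‖x‖ + (t + ‖x‖ + 2 * ε) = 2 * (t + ε) by ring,
      show t + ‖x‖ + 2 * ε - (t - ‖x‖) = 2 * (‖x‖ + ε) by ring,
      mul_div_cancel_left₀ _ (two_ne_zero' ℝ), mul_div_cancel_left₀ _ (two_ne_zero' ℝ)] at h2
    exact (mul_eq_zero.1 h2).resolve_left (by linarith [norm_nonneg x])
  rw [closure_Ioi] at h1
  have h2 := h1 (self_mem_Ici (a := (0 : ℝ)))
  simp only [add_zero] at h2
  rw [← h2]
  exact hrad t _ _ (by rw [norm_smul_axisVec, abs_norm])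

end RadialWave

/-- Below the critical curve (`q₁ < 2`, `q₁q₂((q₂-2)+q₂(q₁-2)) < 1`), any global
spherically symmetric `C²` solution of the Glassey–Strauss system `□φ₁ = |φ₂|^{q₁}`,
`□φ₂ = |∂_tφ₁|^{q₂}` with data supported in the unit ball is supported in the backward
light cone: it vanishes wherever `|x| ≥ 1 - t`. -/
theorem stmt_11 (q1 q2 : ℝ) (hq1 : 1 < q1) (hq2 : 1 < q2) (hq1' : q1 < 2)
    (hsub : q1 * q2 * ((q2 - 2) + q2 * (q1 - 2)) < 1)
    (φ1 φ2 : ℝ → E3 → ℝ)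
    (h1 : ContDiff ℝ 2 (fun p : ℝ × E3 => φ1 p.1 p.2))
    (h2 : ContDiff ℝ 2 (fun p : ℝ × E3 => φ2 p.1 p.2))
    (hrad1 : ∀ t, Radial (φ1 t)) (hrad2 : ∀ t, Radial (φ2 t))
    (heq1 : ∀ (t : ℝ) (x : E3), 0 ≤ t → box φ1 t x = |φ2 t x| ^ q1)
    (heq2 : ∀ (t : ℝ) (x : E3), 0 ≤ t → box φ2 t x = |dtP φ1 t x| ^ q2)
    (hsupp : ∀ x : E3, 1 < ‖x‖ →
      φ1 0 x = 0 ∧ dtP φ1 0 x = 0 ∧ φ2 0 x = 0 ∧ dtP φ2 0 x = 0) :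
    ∀ (t : ℝ) (x : E3), 0 ≤ t → 1 - t ≤ ‖x‖ → φ1 t x = 0 ∧ φ2 t x = 0 := by
  have hw1 := nullWave_of_radial h1 hrad1 (S := fun t x => |φ2 t x| ^ q1)
    (fun t x => rpow_nonneg (abs_nonneg _) _) heq1
    (fun x hx => ⟨(hsupp x hx).1, (hsupp x hx).2.1⟩)
  have hw2 := nullWave_of_radial h2 hrad2 (S := fun t x => |dtP φ1 t x| ^ q2)
    (fun t x => rpow_nonneg (abs_nonneg _) _) heq2
    (fun x hx => (hsupp x hx).2.2)
  have hsys : NullSystem q1 q2 (waveNull φ1) (waveNullV φ1) (waveNullU φ1) (waveNull φ2)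
      (waveNullV φ2) (waveNullU φ2) := by
    constructor
    · convert hw1 using 3 with u v
      rcases eq_or_ne v u with rfl | huv
      · simp
      · rw [waveNull, mul_div_cancel_left₀ _ (div_ne_zero (sub_ne_zero.2 huv) two_ne_zero)]
    · convert hw2 using 3 with u v
      rcases eq_or_ne v u with rfl | huv
      · simp
      · rw [waveNullV_add_waveNullU h1,
          mul_div_cancel_left₀ _ (div_ne_zero (sub_ne_zero.2 huv) two_ne_zero)]
  exact fun t x ht hx =>
    ⟨eq_zero_of_waveNull_eq_zero h1 hrad1
      (fun u v hv hu huv => (hsys.eq_zero hq1 hq2 hq1' hsub hv hu huv).1) ht hx,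
    eq_zero_of_waveNull_eq_zero h2 hrad2
      (fun u v hv hu huv => (hsys.eq_zero hq1 hq2 hq1' hsub hv hu huv).2) ht hx⟩

end
end

section
/- Let q_1, q_2 be real numbers with q_1, q_2 > 1, q_1 < 2 and q_1 q_2 ((q_2 − 2) + q_2(q_1 − 2)) < 1. Then the Glassey–Strauss system □φ_1 = |φ_2|^{q_1}, □φ_2 = |∂_tφ_1|^{q_2} in ℝ^{3+1} admits no global spherically symmetric C² solution on [0,∞) × ℝ³ whose initial data are compactly supported and not all identically zero. -/
open Real Set MeasureTheory

noncomputable section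

theorem hasDerivAt_reflect {f g : ℝ → ℝ} {f' g' T s : ℝ} (h : HasDerivAt f f' (T - s))
    (hg : ∀ x, g x = f (T - x)) (hg' : g' = -f') : HasDerivAt g g' s := by
  have h1 : HasDerivAt (fun x => T - x) (-1) s := (hasDerivAt_id' s).const_sub T
  have h2 := h.comp s h1
  rw [hg', show g = f ∘ fun x => T - x from funext hg]
  exact h2.congr_deriv (by ring)

theorem abs_integral_le_of_abs_le_exp {f : ℝ → ℝ} {C lam t : ℝ} (hC : 0 ≤ C) (hlam : 0 < lam)
    (ht : 0 ≤ t) (hf : ∀ s ∈ Icc 0 t, |f s| ≤ C * exp (lam * s)) :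
    |∫ s in (0 : ℝ)..t, f s| ≤ C / lam * exp (lam * t) := by
  have h1 : |∫ s in (0 : ℝ)..t, f s| ≤ ∫ s in (0 : ℝ)..t, C * exp (lam * s) :=
    intervalIntegral.norm_integral_le_of_norm_le ht
      (Filter.Eventually.of_forall fun s hs => by
        rw [Real.norm_eq_abs]; exact hf s ⟨hs.1.le, hs.2⟩)
      ((by fun_prop : Continuous fun s => C * exp (lam * s)).intervalIntegrable _ _)
  refine h1.trans ?_
  rw [intervalIntegral.integral_const_mul, intervalIntegral.integral_comp_mul_left _ hlam.ne',
    integral_exp, smul_eq_mul]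
  have h2 : C * (lam⁻¹ * (exp (lam * t) - exp (lam * 0))) = C / lam * exp (lam * t) - C / lam := by
    simp only [mul_zero, exp_zero]
    field_simp
  rw [h2]
  have : 0 ≤ C / lam := by positivity
  linarith

/-- `w` is a classical solution of the one-dimensional wave equation `w_tt - w_rr = F` at the times
in `I`, with first derivatives `wt`, `wr`; the equation is expressed along the characteristics. -/
structure IsWave (I : Set ℝ) (w wt wr F : ℝ → ℝ → ℝ) : Prop where
  cont : Continuous (Function.uncurry w)
  cont_wt : Continuous (Function.uncurry wt)
  cont_wr : Continuous (Function.uncurry wr)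
  cont_F : Continuous (Function.uncurry F)
  time : ∀ s r, HasDerivAt (fun s => w s r) (wt s r) s
  space : ∀ s r, HasDerivAt (fun r => w s r) (wr s r) r
  out : ∀ c s, HasDerivAt (fun s => w s (s + c)) (wt s (s + c) + wr s (s + c)) s
  inc : ∀ c s, HasDerivAt (fun s => w s (c - s)) (wt s (c - s) - wr s (c - s)) s
  out_sub : ∀ c, ∀ s ∈ I, HasDerivAt (fun s => wt s (s + c) - wr s (s + c)) (F s (s + c)) s
  inc_add : ∀ c, ∀ s ∈ I, HasDerivAt (fun s => wt s (c - s) + wr s (c - s)) (F s (c - s)) s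

namespace IsWave

variable {I : Set ℝ} {w wt wr F : ℝ → ℝ → ℝ}

theorem mono {J : Set ℝ} (h : IsWave I w wt wr F) (hJ : J ⊆ I) : IsWave J w wt wr F :=
  { h with
    out_sub := fun c s hs => h.out_sub c s (hJ hs)
    inc_add := fun c s hs => h.inc_add c s (hJ hs) }

theorem continuous_inc (h : IsWave I w wt wr F) (c : ℝ) : Continuous fun s => F s (c - s) :=
  h.cont_F.comp (f := fun s : ℝ => (s, c - s)) (by fun_prop)

theorem continuous_out (h : IsWave I w wt wr F) (c : ℝ) : Continuous fun s => F s (s + c) :=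
  h.cont_F.comp (f := fun s : ℝ => (s, s + c)) (by fun_prop)

theorem integral_inc (h : IsWave I w wt wr F) {t : ℝ} (r : ℝ) (ht : 0 ≤ t) (hI : Icc 0 t ⊆ I) :
    wt t r + wr t r = wt 0 (t + r) + wr 0 (t + r) + ∫ s in (0 : ℝ)..t, F s (t + r - s) := by
  rw [intervalIntegral.integral_eq_sub_of_hasDerivAt
    (f := fun s => wt s (t + r - s) + wr s (t + r - s))
    (fun s hs => h.inc_add (t + r) s (hI (by rwa [uIcc_of_le ht] at hs)))
    ((h.continuous_inc _).intervalIntegrable _ _)]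
  simp

theorem integral_out (h : IsWave I w wt wr F) {t : ℝ} (r : ℝ) (ht : 0 ≤ t) (hI : Icc 0 t ⊆ I) :
    wt t r - wr t r = wt 0 (r - t) - wr 0 (r - t) + ∫ s in (0 : ℝ)..t, F s (s + (r - t)) := by
  rw [intervalIntegral.integral_eq_sub_of_hasDerivAt
    (f := fun s => wt s (s + (r - t)) - wr s (s + (r - t)))
    (fun s hs => h.out_sub (r - t) s (hI (by rwa [uIcc_of_le ht] at hs)))
    ((h.continuous_out _).intervalIntegrable _ _)]
  simp

/-- Time reversal. -/
theorem reverse {T : ℝ} (h : IsWave (Icc 0 T) w wt wr F) :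
    IsWave (Icc 0 T) (fun s r => w (T - s) r) (fun s r => -wt (T - s) r)
      (fun s r => wr (T - s) r) (fun s r => F (T - s) r) where
  cont := h.cont.comp (f := fun p : ℝ × ℝ => (T - p.1, p.2)) (by fun_prop)
  cont_wt := (h.cont_wt.comp (f := fun p : ℝ × ℝ => (T - p.1, p.2)) (by fun_prop)).neg
  cont_wr := h.cont_wr.comp (f := fun p : ℝ × ℝ => (T - p.1, p.2)) (by fun_prop)
  cont_F := h.cont_F.comp (f := fun p : ℝ × ℝ => (T - p.1, p.2)) (by fun_prop)
  time s r := hasDerivAt_reflect (h.time (T - s) r) (fun _ => rfl) rfl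
  space s r := h.space (T - s) r
  out c s := by
    refine hasDerivAt_reflect (h.inc (T + c) (T - s)) (fun x => ?_) ?_
    · rw [show T + c - (T - x) = x + c by ring]
    · rw [show T + c - (T - s) = s + c by ring]
      ring
  inc c s := by
    refine hasDerivAt_reflect (h.out (c - T) (T - s)) (fun x => ?_) ?_
    · rw [show T - x + (c - T) = c - x by ring]
    · rw [show T - s + (c - T) = c - s by ring]
      ring
  out_sub c s hs := by
    have := (h.inc_add (T + c) (T - s) ⟨by linarith [hs.2], by linarith [hs.1]⟩).neg
    refine hasDerivAt_reflect this (fun x => ?_) ?_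
    · simp only [Pi.neg_apply]
      rw [show T + c - (T - x) = x + c by ring]
      ring
    · rw [show T + c - (T - s) = s + c by ring]
      ring
  inc_add c s hs := by
    have := (h.out_sub (c - T) (T - s) ⟨by linarith [hs.2], by linarith [hs.1]⟩).neg
    refine hasDerivAt_reflect this (fun x => ?_) ?_
    · simp only [Pi.neg_apply]
      rw [show T - x + (c - T) = c - x by ring]
      ring
    · rw [show T - s + (c - T) = c - s by ring]
      ring

/-- With vanishing data on the base of a triangle of dependence, the time derivative is controlled
by a bound on the source there. -/
theorem abs_wt_le {T r₀ C lam : ℝ} (h : IsWave (Icc 0 T) w wt wr F) (hlam : 0 < lam)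
    (hF : ∀ s ∈ Icc 0 T, ∀ r, |r - r₀| ≤ T - s → |F s r| ≤ C * exp (lam * s))
    (hdata : ∀ r, |r - r₀| ≤ T → wt 0 r = 0 ∧ wr 0 r = 0) (hC : 0 ≤ C)
    {t r : ℝ} (ht : t ∈ Icc 0 T) (hr : |r - r₀| ≤ T - t) :
    |wt t r| ≤ C / lam * exp (lam * t) := by
  have hI : Icc 0 t ⊆ Icc 0 T := Icc_subset_Icc_right ht.2
  rw [abs_le] at hr
  have hA := h.integral_inc r ht.1 hI
  have hB := h.integral_out r ht.1 hI
  have h1 := hdata (t + r) (abs_le.2 ⟨by linarith [ht.1], by linarith [ht.1]⟩)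
  have h2 := hdata (r - t) (abs_le.2 ⟨by linarith [ht.1], by linarith [ht.1]⟩)
  have kA := abs_integral_le_of_abs_le_exp (f := fun s => F s (t + r - s)) hC hlam ht.1
    fun s hs => hF s (hI hs) _
    (abs_le.2 ⟨by linarith [hs.1, hs.2], by linarith [hs.1, hs.2]⟩)
  have kB := abs_integral_le_of_abs_le_exp (f := fun s => F s (s + (r - t))) hC hlam ht.1
    fun s hs => hF s (hI hs) _
    (abs_le.2 ⟨by linarith [hs.1, hs.2], by linarith [hs.1, hs.2]⟩)
  rw [h1.1, h1.2] at hA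
  rw [h2.1, h2.2] at hB
  rw [abs_le] at kA kB ⊢
  constructor <;> linarith

theorem eq_zero_of_triangle {v vt vr G : ℝ → ℝ → ℝ} {T r₀ K : ℝ}
    (hu : IsWave (Icc 0 T) w wt wr F) (hv : IsWave (Icc 0 T) v vt vr G) (hT : 0 ≤ T) (hK : 0 ≤ K)
    (hF : ∀ s ∈ Icc 0 T, ∀ r, |r - r₀| ≤ T - s → |F s r| ≤ K * |v s r|)
    (hG : ∀ s ∈ Icc 0 T, ∀ r, |r - r₀| ≤ T - s → |G s r| ≤ K * |wt s r|)
    (hdu : ∀ r, |r - r₀| ≤ T → w 0 r = 0 ∧ wt 0 r = 0 ∧ wr 0 r = 0)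
    (hdv : ∀ r, |r - r₀| ≤ T → v 0 r = 0 ∧ vt 0 r = 0 ∧ vr 0 r = 0) :
    w T r₀ = 0 ∧ wt T r₀ = 0 ∧ v T r₀ = 0 ∧ vt T r₀ = 0 := by
  set lam := 4 * (K + 1) with hlam_def
  have hlam : 0 < lam := by positivity
  set S : Set (ℝ × ℝ) := {p | p.1 ∈ Icc 0 T ∧ |p.2 - r₀| ≤ T - p.1} with hS
  have hScompact : IsCompact S := by
    apply IsCompact.of_isClosed_subset (isCompact_Icc (a := ((0 : ℝ), r₀ - T)) (b := (T, r₀ + T)))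
    · have h1 : IsClosed {p : ℝ × ℝ | p.1 ∈ Icc 0 T} := isClosed_Icc.preimage continuous_fst
      have h2 : IsClosed {p : ℝ × ℝ | |p.2 - r₀| ≤ T - p.1} :=
        isClosed_le (by fun_prop) (by fun_prop)
      exact h1.inter h2
    · rintro ⟨s, r⟩ ⟨hs, hr⟩
      simp only [abs_le] at hr
      refine ⟨⟨hs.1, ?_⟩, ⟨hs.2, ?_⟩⟩ <;> simp only <;> linarith [hs.1, hr.1, hr.2]
  have hcont : Continuous fun p : ℝ × ℝ =>
      exp (-(lam * p.1)) * (|wt p.1 p.2| + |v p.1 p.2|) := by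
    have := hu.cont_wt
    have := hv.cont
    unfold Function.uncurry at *
    fun_prop
  obtain ⟨p, hp, hmax⟩ := hScompact.exists_isMaxOn ⟨(T, r₀), ⟨hT, le_rfl⟩, by simp⟩
    hcont.continuousOn
  set M := exp (-(lam * p.1)) * (|wt p.1 p.2| + |v p.1 p.2|) with hM
  have hM0 : 0 ≤ M := by positivity
  have hbound : ∀ s ∈ Icc 0 T, ∀ r, |r - r₀| ≤ T - s →
      |wt s r| + |v s r| ≤ M * exp (lam * s) := by
    intro s hs r hr
    have h1 := hmax (show (s, r) ∈ S from ⟨hs, hr⟩)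
    calc |wt s r| + |v s r|
        = exp (-(lam * s)) * (|wt s r| + |v s r|) * exp (lam * s) := by
          rw [mul_right_comm, ← exp_add]; simp
      _ ≤ M * exp (lam * s) := mul_le_mul_of_nonneg_right h1 (exp_pos _).le
  have hub : ∀ t ∈ Icc 0 T, ∀ r, |r - r₀| ≤ T - t →
      |wt t r| ≤ K * M / lam * exp (lam * t) := by
    intro t ht r hr
    refine hu.abs_wt_le hlam ?_ (fun r hr => (hdu r hr).2) (by positivity) ht hr
    intro s hs r hr
    refine (hF s hs r hr).trans ?_
    have := hbound s hs r hr
    rw [mul_assoc]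
    gcongr
    linarith [abs_nonneg (wt s r)]
  have hvtb : ∀ t ∈ Icc 0 T, ∀ r, |r - r₀| ≤ T - t →
      |vt t r| ≤ K * M / lam * exp (lam * t) := by
    intro t ht r hr
    refine hv.abs_wt_le hlam ?_ (fun r hr => (hdv r hr).2) (by positivity) ht hr
    intro s hs r hr
    refine (hG s hs r hr).trans ?_
    have := hbound s hs r hr
    rw [mul_assoc]
    gcongr
    linarith [abs_nonneg (v s r)]
  have htime : ∀ {f ft fr Φ : ℝ → ℝ → ℝ}, IsWave (Icc 0 T) f ft fr Φ →
      (∀ r, |r - r₀| ≤ T → f 0 r = 0) → ∀ C, 0 ≤ C →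
      (∀ t ∈ Icc 0 T, ∀ r, |r - r₀| ≤ T - t → |ft t r| ≤ C * exp (lam * t)) →
      ∀ t ∈ Icc 0 T, ∀ r, |r - r₀| ≤ T - t → |f t r| ≤ C / lam * exp (lam * t) := by
    intro f ft fr Φ hf h0 C hC hb t ht r hr
    have hc : Continuous fun s => ft s r :=
      hf.cont_wt.comp (f := fun s : ℝ => (s, r)) (by fun_prop)
    have h1 : f t r = ∫ s in (0 : ℝ)..t, ft s r := by
      rw [intervalIntegral.integral_eq_sub_of_hasDerivAt (f := fun s => f s r)
        (fun s _ => hf.time s r) (hc.intervalIntegrable _ _), h0 r (by linarith [ht.1]), sub_zero]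
    rw [h1]
    exact abs_integral_le_of_abs_le_exp hC hlam ht.1 fun s hs =>
      hb s ⟨hs.1, hs.2.trans ht.2⟩ r (by linarith [hs.2])
  have hvb := htime hv (fun r hr => (hdv r hr).1) (K * M / lam) (by positivity) hvtb
  have hMzero : M = 0 := by
    have h1 := hub p.1 hp.1 p.2 hp.2
    have h2 := hvb p.1 hp.1 p.2 hp.2
    have h3 : M ≤ K * M / lam + K * M / lam / lam := by
      calc M ≤ exp (-(lam * p.1)) * (K * M / lam * exp (lam * p.1)
            + K * M / lam / lam * exp (lam * p.1)) := by rw [hM]; gcongr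
        _ = (K * M / lam + K * M / lam / lam) * (exp (-(lam * p.1)) * exp (lam * p.1)) := by ring
        _ = _ := by rw [← exp_add]; simp
    have h4 : K * M / lam ≤ M / 4 := by
      rw [div_le_div_iff₀ hlam (by norm_num)]
      nlinarith
    have h5 : K * M / lam / lam ≤ K * M / lam := div_le_self (by positivity) (by linarith)
    linarith
  have hTT : T ∈ Icc 0 T := ⟨hT, le_rfl⟩
  have hr₀ : |r₀ - r₀| ≤ T - T := by simp
  have hwb := htime hu (fun r hr => (hdu r hr).1) (K * M / lam) (by positivity) hub
    T hTT r₀ hr₀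
  have e1 := hub T hTT r₀ hr₀
  have e2 := hvb T hTT r₀ hr₀
  have e3 := hvtb T hTT r₀ hr₀
  simp only [hMzero, mul_zero, zero_div, zero_mul, abs_nonpos_iff] at hwb e1 e2 e3
  exact ⟨hwb, e1, e2, e3⟩

theorem integral_le_add (h : IsWave (Ici 0) w wt wr F) (hF : ∀ t r, 0 ≤ t → 0 ≤ r → 0 ≤ F t r)
    {t r s₀ s₁ : ℝ} (hdata : wt 0 (t + r) + wr 0 (t + r) = 0) (ht : 0 ≤ t) (hr : 0 ≤ r)
    (hs₀ : 0 ≤ s₀) (hs : s₀ ≤ s₁) (hs₁ : s₁ ≤ t) :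
    ∫ s in s₀..s₁, F s (t + r - s) ≤ wt t r + wr t r := by
  rw [h.integral_inc r ht Icc_subset_Ici_self, hdata, zero_add]
  refine intervalIntegral.integral_mono_interval hs₀ hs hs₁ ?_
    ((h.continuous_inc _).intervalIntegrable _ _)
  refine (ae_restrict_iff' measurableSet_Ioc).2 (Filter.Eventually.of_forall fun s hs => ?_)
  exact hF s _ hs.1.le (by linarith [hs.2])

theorem hasDerivAt_ray (h : IsWave I w wt wr F) (ξ ρ : ℝ) :
    HasDerivAt (fun ρ => w (ξ + ρ) ρ) (wt (ξ + ρ) ρ + wr (ξ + ρ) ρ) ρ := by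
  have h1 := (h.out (-ξ) (ξ + ρ)).comp_const_add ξ ρ
  simpa only [add_neg_cancel_comm] using h1

theorem ray_growth (h : IsWave I w wt wr F) {ξ r₁ r₂ m : ℝ} (hr : r₁ ≤ r₂)
    (hm : ∀ ρ ∈ Icc r₁ r₂, m ≤ wt (ξ + ρ) ρ + wr (ξ + ρ) ρ) :
    w (ξ + r₁) r₁ + m * (r₂ - r₁) ≤ w (ξ + r₂) r₂ := by
  have hd := fun ρ => h.hasDerivAt_ray ξ ρ
  have := Convex.mul_sub_le_image_sub_of_le_deriv (convex_Icc r₁ r₂)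
    (f := fun ρ => w (ξ + ρ) ρ)
    (fun ρ _ => (hd ρ).continuousAt.continuousWithinAt)
    (fun ρ _ => (hd ρ).differentiableAt.differentiableWithinAt) (C := m)
    (fun ρ hρ => by rw [(hd ρ).deriv]; exact hm ρ (interior_subset hρ))
    r₁ ⟨le_rfl, hr⟩ r₂ ⟨hr, le_rfl⟩ hr
  linarith

end IsWave

/-- A form of Jensen's inequality for the power `q`. -/
theorem rpow_mul_rpow_le_integral {f : ℝ → ℝ} (hf : Continuous f) {a b y q : ℝ} (hab : a < b)
    (hq : 1 ≤ q) (hpos : ∀ s ∈ Icc a b, 0 ≤ f s) (hy : 0 ≤ y) (hint : y ≤ ∫ s in a..b, f s) :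
    (b - a) ^ (1 - q) * y ^ q ≤ ∫ s in a..b, f s ^ q := by
  have hL : 0 < b - a := sub_pos.2 hab
  have hcq : Continuous fun s => f s ^ q := hf.rpow_const fun _ => Or.inr (by linarith)
  rcases hy.eq_or_lt with rfl | hy
  · rw [zero_rpow (by linarith), mul_zero]
    exact intervalIntegral.integral_nonneg hab.le fun s hs => rpow_nonneg (hpos s hs) _
  set x := y / (b - a) with hx
  have hx0 : 0 < x := by positivity
  have hpt : ∀ s ∈ Icc a b, x ^ q + q * x ^ (q - 1) * (f s - x) ≤ f s ^ q := by
    intro s hs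
    have h1 := one_add_mul_self_le_rpow_one_add (s := f s / x - 1) (p := q)
      (by linarith [div_nonneg (hpos s hs) hx0.le]) hq
    rw [add_sub_cancel, div_rpow (hpos s hs) hx0.le] at h1
    have hxq : 0 < x ^ q := rpow_pos_of_pos hx0 q
    rw [le_div_iff₀ hxq] at h1
    refine le_trans (le_of_eq ?_) h1
    rw [rpow_sub_one hx0.ne']
    field_simp
  have h2 := intervalIntegral.integral_mono_on hab.le
    ((by fun_prop : Continuous fun s => x ^ q + q * x ^ (q - 1) * (f s - x)).intervalIntegrable
      (μ := volume) a b) (hcq.intervalIntegrable _ _) hpt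
  refine le_trans ?_ h2
  rw [intervalIntegral.integral_add (by simp) (Continuous.intervalIntegrable (by fun_prop) _ _),
    intervalIntegral.integral_const_mul,
    intervalIntegral.integral_sub (hf.intervalIntegrable _ _) (by simp),
    intervalIntegral.integral_const, intervalIntegral.integral_const, smul_eq_mul, smul_eq_mul]
  have h3 : (b - a) ^ (1 - q) * y ^ q = (b - a) * x ^ q := by
    rw [hx, div_rpow hy.le hL.le, rpow_sub hL, rpow_one]
    field_simp
  have h4 : (b - a) * x = y := by rw [hx]; field_simp
  rw [h3, h4]
  have : 0 ≤ q * x ^ (q - 1) * ((∫ s in a..b, f s) - y) := by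
    have : 0 ≤ (∫ s in a..b, f s) - y := sub_nonneg.2 hint
    positivity
  linarith

/-- The Glassey–Strauss system for the radial functions `u = r φ₁`, `v = r φ₂`, for data
supported in `r ≤ R`. -/
structure RadialSystem (q1 q2 R : ℝ) (u ut ur v vt vr F G : ℝ → ℝ → ℝ) : Prop where
  wave_u : IsWave (Ici 0) u ut ur F
  wave_v : IsWave (Ici 0) v vt vr G
  one_lt_q1 : 1 < q1
  one_lt_q2 : 1 < q2
  one_le_R : 1 ≤ R
  u_center : ∀ t, u t 0 = 0
  v_center : ∀ t, v t 0 = 0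
  F_center : ∀ t, F t 0 = 0
  G_center : ∀ t, G t 0 = 0
  F_eq : ∀ t r, 0 ≤ t → 0 < r → F t r = r ^ (1 - q1) * |v t r| ^ q1
  G_eq : ∀ t r, 0 ≤ t → 0 < r → G t r = r ^ (1 - q2) * |ut t r| ^ q2
  u_data : ∀ r, R ≤ r → ut 0 r + ur 0 r = 0
  v_data : ∀ r, R ≤ r → vt 0 r + vr 0 r = 0
  u_out : ∀ t r, 0 ≤ t → R + t ≤ r → u t r = 0

namespace RadialSystem

variable {q1 q2 R : ℝ} {u ut ur v vt vr F G : ℝ → ℝ → ℝ}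

theorem F_nonneg (h : RadialSystem q1 q2 R u ut ur v vt vr F G) (t r : ℝ) (ht : 0 ≤ t)
    (hr : 0 ≤ r) : 0 ≤ F t r := by
  rcases hr.eq_or_lt with rfl | hr
  · exact (h.F_center t).ge
  · rw [h.F_eq t r ht hr]; positivity

theorem G_nonneg (h : RadialSystem q1 q2 R u ut ur v vt vr F G) (t r : ℝ) (ht : 0 ≤ t)
    (hr : 0 ≤ r) : 0 ≤ G t r := by
  rcases hr.eq_or_lt with rfl | hr
  · exact (h.G_center t).ge
  · rw [h.G_eq t r ht hr]; positivity

theorem u_add_nonneg (h : RadialSystem q1 q2 R u ut ur v vt vr F G) {t r : ℝ} (ht : 0 ≤ t)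
    (hr : 0 ≤ r) (hR : R ≤ t + r) : 0 ≤ ut t r + ur t r := by
  simpa using h.wave_u.integral_le_add h.F_nonneg (h.u_data _ hR) ht hr le_rfl le_rfl ht

theorem v_add_nonneg (h : RadialSystem q1 q2 R u ut ur v vt vr F G) {t r : ℝ} (ht : 0 ≤ t)
    (hr : 0 ≤ r) (hR : R ≤ t + r) : 0 ≤ vt t r + vr t r := by
  simpa using h.wave_v.integral_le_add h.G_nonneg (h.v_data _ hR) ht hr le_rfl le_rfl ht

theorem u_mono (h : RadialSystem q1 q2 R u ut ur v vt vr F G) {ξ r₁ r₂ : ℝ} (hξ : R ≤ ξ)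
    (hr₁ : 0 ≤ r₁) (hr : r₁ ≤ r₂) : u (ξ + r₁) r₁ ≤ u (ξ + r₂) r₂ := by
  have := h.one_le_R
  simpa using h.wave_u.ray_growth (ξ := ξ) (m := 0) hr fun ρ hρ =>
    h.u_add_nonneg (by linarith [hρ.1]) (by linarith [hρ.1]) (by linarith [hρ.1])

theorem v_mono (h : RadialSystem q1 q2 R u ut ur v vt vr F G) {ξ r₁ r₂ : ℝ} (hξ : R ≤ ξ)
    (hr₁ : 0 ≤ r₁) (hr : r₁ ≤ r₂) : v (ξ + r₁) r₁ ≤ v (ξ + r₂) r₂ := by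
  have := h.one_le_R
  simpa using h.wave_v.ray_growth (ξ := ξ) (m := 0) hr fun ρ hρ =>
    h.v_add_nonneg (by linarith [hρ.1]) (by linarith [hρ.1]) (by linarith [hρ.1])

theorem u_nonneg (h : RadialSystem q1 q2 R u ut ur v vt vr F G) {ξ r : ℝ} (hξ : R ≤ ξ)
    (hr : 0 ≤ r) : 0 ≤ u (ξ + r) r := by
  simpa [h.u_center] using h.u_mono hξ le_rfl hr

theorem v_nonneg (h : RadialSystem q1 q2 R u ut ur v vt vr F G) {ξ r : ℝ} (hξ : R ≤ ξ)
    (hr : 0 ≤ r) : 0 ≤ v (ξ + r) r := by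
  simpa [h.v_center] using h.v_mono hξ le_rfl hr

theorem v_rate (h : RadialSystem q1 q2 R u ut ur v vt vr F G) {η ρ t r : ℝ} (hη : R ≤ η)
    (hρ : 0 < ρ) (hr : 0 ≤ r) (ht : η + ρ ≤ t) (htr : t + r = η + 2 * ρ) :
    (ρ + η + R) ^ (1 - q2) * (((η + R) / 2) ^ (1 - q2) * (u (η + ρ) ρ / 2) ^ q2)
      ≤ vt t r + vr t r := by
  have hR := h.one_le_R
  have hq2 := h.one_lt_q2
  set s₀ := (t + r - R) / 2 with hs₀
  set s₁ := η + ρ with hs₁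
  have hlen : s₁ - s₀ = (η + R) / 2 := by rw [hs₀, hs₁, htr]; ring
  have h0 : 0 ≤ s₀ := by rw [hs₀]; linarith
  have h01 : s₀ < s₁ := by linarith
  have hcont : Continuous fun s => |ut s (t + r - s)| :=
    (h.wave_u.cont_wt.comp (f := fun s : ℝ => (s, t + r - s)) (by fun_prop)).abs
  have hder : ∫ s in s₀..s₁, (ut s (t + r - s) - ur s (t + r - s)) = u s₁ ρ := by
    rw [intervalIntegral.integral_eq_sub_of_hasDerivAt (f := fun s => u s (t + r - s))
      (fun s _ => h.wave_u.inc (t + r) s)]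
    · rw [h.u_out s₀ (t + r - s₀) h0 (by rw [hs₀]; linarith), sub_zero,
        show t + r - s₁ = ρ by rw [htr, hs₁]; ring]
    · exact ((h.wave_u.cont_wt.comp (f := fun s : ℝ => (s, t + r - s)) (by fun_prop)).sub
        (h.wave_u.cont_wr.comp (f := fun s : ℝ => (s, t + r - s))
          (by fun_prop))).intervalIntegrable _ _
  have hint : u s₁ ρ / 2 ≤ ∫ s in s₀..s₁, |ut s (t + r - s)| := by
    rw [← hder, ← intervalIntegral.integral_div]
    refine intervalIntegral.integral_mono_on h01.le ?_ (hcont.intervalIntegrable _ _) ?_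
    · exact (((h.wave_u.cont_wt.comp (f := fun s : ℝ => (s, t + r - s)) (by fun_prop)).sub
        (h.wave_u.cont_wr.comp (f := fun s : ℝ => (s, t + r - s))
          (by fun_prop))).div_const 2).intervalIntegrable _ _
    · intro s hs
      have := h.u_add_nonneg (t := s) (r := t + r - s) (h0.trans hs.1) (by linarith [hs.2])
        (by linarith)
      linarith [le_abs_self (ut s (t + r - s))]
  have hJ := rpow_mul_rpow_le_integral hcont h01 hq2.le (fun s _ => abs_nonneg _)
    (by linarith [h.u_nonneg hη hρ.le] : 0 ≤ u s₁ ρ / 2) hint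
  rw [hlen] at hJ
  refine le_trans ?_ (h.wave_v.integral_le_add h.G_nonneg (h.v_data _ (by linarith))
    (by linarith) hr h0 h01.le ht)
  calc (ρ + η + R) ^ (1 - q2) * (((η + R) / 2) ^ (1 - q2) * (u s₁ ρ / 2) ^ q2)
      ≤ (ρ + η + R) ^ (1 - q2) * ∫ s in s₀..s₁, |ut s (t + r - s)| ^ q2 := by
        gcongr
        exact rpow_nonneg (by linarith) _
    _ = ∫ s in s₀..s₁, (ρ + η + R) ^ (1 - q2) * |ut s (t + r - s)| ^ q2 := by
        rw [intervalIntegral.integral_const_mul]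
    _ ≤ ∫ s in s₀..s₁, G s (t + r - s) := by
        refine intervalIntegral.integral_mono_on h01.le
          ((continuous_const.mul (hcont.rpow_const fun _ => Or.inr
            (by linarith))).intervalIntegrable _ _)
          ((h.wave_v.continuous_inc _).intervalIntegrable _ _) fun s hs => ?_
        have h1 : 0 < t + r - s := by linarith [hs.2]
        rw [h.G_eq s _ (h0.trans hs.1) h1]
        have h2 : (ρ + η + R) ^ (1 - q2) ≤ (t + r - s) ^ (1 - q2) :=
          rpow_le_rpow_of_nonpos h1 (by linarith [hs.1]) (by linarith)
        gcongr

theorem u_rate (h : RadialSystem q1 q2 R u ut ur v vt vr F G) {η ξ ρ m : ℝ} (hη : R ≤ η)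
    (hξ : η ≤ ξ) (hρ : 0 < ρ) (hm : 0 ≤ m) (hv : ∀ y ∈ Icc η ξ, m ≤ v (y + ρ) ρ) :
    (ξ - η) / 2 * ((ρ + ξ) ^ (1 - q1) * m ^ q1) ≤ ut (ξ + ρ) ρ + ur (ξ + ρ) ρ := by
  have hR := h.one_le_R
  have hq1 := h.one_lt_q1
  refine le_trans ?_ (h.wave_u.integral_le_add h.F_nonneg (h.u_data _ (by linarith))
    (by linarith) hρ.le (s₀ := ρ + (ξ + η) / 2) (s₁ := ξ + ρ) (by linarith) (by linarith) le_rfl)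
  have h1 : (ξ - η) / 2 * ((ρ + ξ) ^ (1 - q1) * m ^ q1)
      = ∫ _ in (ρ + (ξ + η) / 2)..(ξ + ρ), (ρ + ξ) ^ (1 - q1) * m ^ q1 := by
    rw [intervalIntegral.integral_const, smul_eq_mul]
    ring
  rw [h1]
  refine intervalIntegral.integral_mono_on (by linarith) (by simp)
    ((h.wave_u.continuous_inc _).intervalIntegrable _ _) fun s hs => ?_
  have hpos : 0 < ξ + ρ + ρ - s := by linarith [hs.2]
  rw [h.F_eq s _ (by linarith [hs.1]) hpos]
  set y := 2 * s - ξ - 2 * ρ with hy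
  have hy1 : y ∈ Icc η ξ := ⟨by linarith [hs.1], by linarith [hs.2]⟩
  have h2 := h.v_mono (hη.trans hy1.1) hρ.le (by linarith [hs.2] : ρ ≤ ξ + ρ + ρ - s)
  rw [show y + (ξ + ρ + ρ - s) = s by rw [hy]; ring] at h2
  have h3 : m ≤ |v s (ξ + ρ + ρ - s)| := ((hv y hy1).trans h2).trans (le_abs_self _)
  have h4 : (ρ + ξ) ^ (1 - q1) ≤ (ξ + ρ + ρ - s) ^ (1 - q1) :=
    rpow_le_rpow_of_nonpos hpos (by linarith [hs.1]) (by linarith)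
  gcongr

theorem lower_bound_step (h : RadialSystem q1 q2 R u ut ur v vt vr F G) {X τ d m : ℝ}
    (hX : R ≤ X) (hτ : 0 ≤ τ) (hd : 0 < d) (hτd : τ + 2 * d ≤ 1) (hm : 0 ≤ m)
    (hv : ∀ ξ ∈ Icc (X * (1 + τ)) (2 * X), ∀ ρ ∈ Icc (2 * X * (1 + τ)) (4 * X),
      m ≤ v (ξ + ρ) ρ) :
    ∀ ξ ∈ Icc (X * (1 + (τ + 2 * d))) (2 * X),
      ∀ ρ ∈ Icc (2 * X * (1 + (τ + 2 * d))) (4 * X),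
      2 * d * X * ((7 * X) ^ (1 - q2) * ((2 * X) ^ (1 - q2) *
        (2 * d * X * (d * X / 2 * ((6 * X) ^ (1 - q1) * m ^ q1)) / 2) ^ q2)) ≤ v (ξ + ρ) ρ := by
  have hR := h.one_le_R
  have hq1 := h.one_lt_q1
  have hq2 := h.one_lt_q2
  have hX0 : 0 < X := by linarith
  have hdX : 0 < d * X := by positivity
  have hτX : 0 ≤ τ * X := by positivity
  intro ξ hξ ρ hρ
  have hξ1 := hξ.1
  have hξ2 := hξ.2
  have hρ1 := hρ.1
  have hρ2 := hρ.2
  ring_nf at hξ1 hρ1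
  set n := 2 * d * X * (d * X / 2 * ((6 * X) ^ (1 - q1) * m ^ q1)) with hn
  have hn0 : 0 ≤ n := by positivity
  have hu : ∀ y ∈ Icc (2 * X * (1 + τ) + 2 * d * X) (4 * X), n ≤ u (ξ + y) y := by
    intro y hy
    have hy1 := hy.1
    have hy2 := hy.2
    ring_nf at hy1
    have h1 := h.wave_u.ray_growth (ξ := ξ) (r₁ := 2 * X * (1 + τ)) (r₂ := y)
      (m := d * X / 2 * ((6 * X) ^ (1 - q1) * m ^ q1)) (by linarith) fun z hz => by
        have hz1 := hz.1
        have hz2 := hz.2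
        ring_nf at hz1
        refine le_trans ?_ (h.u_rate (η := X * (1 + τ)) (ξ := ξ) (ρ := z) (m := m) (by linarith)
          (by linarith) (by linarith) hm fun y' hy' =>
            hv y' ⟨hy'.1, hy'.2.trans hξ2⟩ z ⟨hz.1, by linarith⟩)
        have h2 : (6 * X) ^ (1 - q1) ≤ (z + ξ) ^ (1 - q1) :=
          rpow_le_rpow_of_nonpos (by linarith) (by linarith) (by linarith)
        exact mul_le_mul (by linarith) (mul_le_mul_of_nonneg_right h2 (by positivity))
          (by positivity) (by linarith)
    have h3 := h.u_nonneg (ξ := ξ) (r := 2 * X * (1 + τ)) (by linarith) (by positivity)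
    have h4 : n ≤ d * X / 2 * ((6 * X) ^ (1 - q1) * m ^ q1) * (y - 2 * X * (1 + τ)) := by
      rw [hn, mul_comm]
      gcongr
      linarith
    linarith
  set k := (7 * X) ^ (1 - q2) * ((2 * X) ^ (1 - q2) * (n / 2) ^ q2) with hk
  have hk0 : 0 ≤ k := by positivity
  have h1 := h.wave_v.ray_growth (ξ := ξ) (r₁ := 2 * X * (1 + τ) + 2 * d * X) (r₂ := ρ)
    (m := k) (by linarith) fun z hz => by
      have hz1 := hz.1
      have hz2 := hz.2
      ring_nf at hz1
      have hz0 : 0 < z := by linarith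
      refine le_trans ?_ (h.v_rate (η := ξ) (ρ := z) (t := ξ + z) (r := z) (by linarith)
        hz0 hz0.le le_rfl (by ring))
      have h2 : (7 * X) ^ (1 - q2) ≤ (z + ξ + R) ^ (1 - q2) :=
        rpow_le_rpow_of_nonpos (by linarith) (by linarith) (by linarith)
      have h3 : (2 * X) ^ (1 - q2) ≤ ((ξ + R) / 2) ^ (1 - q2) :=
        rpow_le_rpow_of_nonpos (by linarith) (by linarith) (by linarith)
      have h4 := hu z ⟨hz.1, by linarith⟩
      rw [hk]
      gcongr
      all_goals exact rpow_nonneg (by linarith) _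
  have h3 := h.v_nonneg (ξ := ξ) (r := 2 * X * (1 + τ) + 2 * d * X) (by linarith) (by positivity)
  have h4 : 2 * d * X * k ≤ k * (ρ - (2 * X * (1 + τ) + 2 * d * X)) := by
    rw [mul_comm]
    gcongr
    linarith
  linarith

/-- The lower bound that starts the iteration. -/
theorem exists_initial_lower_bound (h : RadialSystem q1 q2 R u ut ur v vt vr F G) {a b r₀ ε : ℝ}
    (ha : R ≤ a) (hab : a < b) (hr₀ : 0 < r₀) (hε : 0 < ε)
    (hv : ∀ ξ ∈ Icc a b, ε ≤ v (ξ + r₀) r₀) :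
    ∃ c > 0, ∃ X₀, ∀ X ≥ X₀, ∀ ξ ∈ Icc X (2 * X), ∀ ρ ∈ Icc (2 * X) (4 * X),
      c * X ^ (2 + q2 - q1 * q2) ≤ v (ξ + ρ) ρ := by
  have hR := h.one_le_R
  have hq1 := h.one_lt_q1
  have hq2 := h.one_lt_q2
  have hba : 0 < b - a := sub_pos.2 hab
  have hbR : 0 < b + R := by linarith
  set c₁ := (b - a) / 4 * (4 ^ (1 - q1) * ε ^ q1) with hc₁
  have hc₁0 : 0 < c₁ := by positivity
  refine ⟨5 ^ (1 - q2) * (((b + R) / 2) ^ (1 - q2) * (c₁ / 2) ^ q2), by positivity,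
    R + b + 2 * r₀, fun X hX ξ hξ ρ hρ => ?_⟩
  have hX0 : 0 < X := by linarith
  have hu : ∀ y ∈ Icc X (3 * X), c₁ * X ^ (2 - q1) ≤ u (b + y) y := by
    intro y hy
    have h1 := h.wave_u.ray_growth (ξ := b) (r₁ := r₀) (r₂ := y)
      (m := (b - a) / 2 * ((4 * X) ^ (1 - q1) * ε ^ q1)) (by linarith [hy.1]) fun z hz => by
        have hz1 := hz.1
        have hz2 := hz.2
        refine le_trans ?_ (h.u_rate (η := a) (ξ := b) (ρ := z) (m := ε) ha hab.le
          (by linarith) hε.le fun y' hy' =>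
            (hv y' hy').trans (h.v_mono (ha.trans hy'.1) hr₀.le hz1))
        have h2 : (4 * X) ^ (1 - q1) ≤ (z + b) ^ (1 - q1) :=
          rpow_le_rpow_of_nonpos (by linarith) (by linarith [hy.2]) (by linarith)
        gcongr
    have h3 := h.u_nonneg (ξ := b) (r := r₀) (by linarith) hr₀.le
    have h4 : c₁ * X ^ (2 - q1)
        ≤ (b - a) / 2 * ((4 * X) ^ (1 - q1) * ε ^ q1) * (y - r₀) := by
      calc c₁ * X ^ (2 - q1)
          = (b - a) / 2 * ((4 * X) ^ (1 - q1) * ε ^ q1) * (X / 2) := by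
            rw [hc₁, mul_rpow (by norm_num) hX0.le, show 2 - q1 = 1 - q1 + 1 by ring,
              rpow_add_one hX0.ne']
            ring
        _ ≤ _ := by
            gcongr
            linarith [hy.1]
    linarith
  have hξ1 := hξ.1
  have hξ2 := hξ.2
  set k := (5 * X) ^ (1 - q2) * (((b + R) / 2) ^ (1 - q2) * (c₁ * X ^ (2 - q1) / 2) ^ q2) with hk
  have h1 := h.wave_v.ray_growth (ξ := ξ) (r₁ := X) (r₂ := 2 * X) (m := k) (by linarith)
    fun z hz => by
      have hz1 := hz.1
      have hz2 := hz.2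
      have hz0 : 0 < z := by linarith
      refine le_trans ?_ (h.v_rate (η := b) (ρ := z + (ξ - b) / 2) (t := ξ + z) (r := z)
        (by linarith) (by linarith) hz0.le (by linarith) (by ring))
      have h2 : (5 * X) ^ (1 - q2) ≤ (z + (ξ - b) / 2 + b + R) ^ (1 - q2) :=
        rpow_le_rpow_of_nonpos (by linarith) (by linarith) (by linarith)
      have h4 := hu (z + (ξ - b) / 2) ⟨by linarith, by linarith⟩
      rw [hk]
      gcongr
      all_goals exact rpow_nonneg (by linarith) _
  have h3 := h.v_nonneg (ξ := ξ) (r := X) (by linarith) hX0.le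
  have h5 := h.v_mono (ξ := ξ) (r₁ := 2 * X) (r₂ := ρ) (by linarith) (by linarith) hρ.1
  have h6 : 5 ^ (1 - q2) * (((b + R) / 2) ^ (1 - q2) * (c₁ / 2) ^ q2) * X ^ (2 + q2 - q1 * q2)
      = k * (2 * X - X) := by
    rw [hk, mul_rpow (by norm_num) hX0.le, show c₁ * X ^ (2 - q1) / 2 = c₁ / 2 * X ^ (2 - q1) by
      ring, mul_rpow (by positivity) (by positivity), ← rpow_mul hX0.le,
      show 2 + q2 - q1 * q2 = (1 - q2) + (2 - q1) * q2 + 1 by ring, rpow_add_one hX0.ne',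
      rpow_add hX0]
    ring
  linarith

theorem step_constant {q1 q2 X d m : ℝ} (hX : 0 < X) (hd : 0 < d) (hm : 0 ≤ m) :
    2 * d * X * ((7 * X) ^ (1 - q2) * ((2 * X) ^ (1 - q2) *
        (2 * d * X * (d * X / 2 * ((6 * X) ^ (1 - q1) * m ^ q1)) / 2) ^ q2))
      = 2 * 7 ^ (1 - q2) * 2 ^ (1 - q2) * (6 ^ (1 - q1) / 2) ^ q2 * d ^ (1 + 2 * q2)
        * X ^ (3 + q2 - q1 * q2) * m ^ (q1 * q2) := by
  have h1 : 2 * d * X * (d * X / 2 * ((6 * X) ^ (1 - q1) * m ^ q1)) / 2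
      = 6 ^ (1 - q1) / 2 * d ^ (2 : ℝ) * X ^ (3 - q1) * m ^ q1 := by
    rw [mul_rpow (by norm_num) hX.le, show 3 - q1 = (1 - q1) + 2 by ring, rpow_add hX,
      rpow_two, rpow_two]
    ring
  have h2 : (6 ^ (1 - q1) / 2 * d ^ (2 : ℝ) * X ^ (3 - q1) * m ^ q1) ^ q2
      = (6 ^ (1 - q1) / 2) ^ q2 * d ^ (2 * q2) * X ^ ((3 - q1) * q2) * m ^ (q1 * q2) := by
    rw [mul_rpow (by positivity) (by positivity), mul_rpow (by positivity) (by positivity),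
      mul_rpow (by positivity) (by positivity), rpow_mul hd.le, rpow_mul hX.le, rpow_mul hm]
  rw [h1, h2, mul_rpow (by norm_num) hX.le, mul_rpow (by norm_num) hX.le,
    show 3 + q2 - q1 * q2 = 1 + (1 - q2) + (1 - q2) + (3 - q1) * q2 by ring, rpow_add hX,
    rpow_add hX, rpow_add hX, rpow_add hd, rpow_one, rpow_one]
  ring

/-- A nontrivial far field of `v` leads to blow-up below the critical curve. -/
theorem false_of_pos (h : RadialSystem q1 q2 R u ut ur v vt vr F G)
    (hsub : q1 * q2 * ((q2 - 2) + q2 * (q1 - 2)) < 1) {a b r₀ ε : ℝ}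
    (ha : R ≤ a) (hab : a < b) (hr₀ : 0 < r₀) (hε : 0 < ε)
    (hv : ∀ ξ ∈ Icc a b, ε ≤ v (ξ + r₀) r₀) : False := by
  have hR := h.one_le_R
  have hq1 := h.one_lt_q1
  have hq2 := h.one_lt_q2
  obtain ⟨c, hc, X₀, hX₀⟩ := h.exists_initial_lower_bound ha hab hr₀ hε hv
  set Q := q1 * q2 with hQ
  have hQ1 : 0 < Q - 1 := by nlinarith
  set e := 1 + 2 * q2 with he
  set c₃ : ℝ := 2 * 7 ^ (1 - q2) * 2 ^ (1 - q2) * (6 ^ (1 - q1) / 2) ^ q2 with hc₃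
  have hc₃0 : 0 < c₃ := by positivity
  obtain ⟨B, hB1, hBQ⟩ : ∃ B : ℝ, 1 < B ∧ B ^ (Q - 1) = 2 ^ e :=
    ⟨2 ^ (e / (Q - 1)), one_lt_rpow (by norm_num) (by positivity), by
      rw [← rpow_mul (by norm_num), div_mul_cancel₀ _ hQ1.ne']⟩
  have hexp : 0 < 1 + (2 + q2 - Q) * Q := by nlinarith
  have hlarge := ((tendsto_rpow_atTop hexp).const_mul_atTop
    (show 0 < c₃ * (1 / 4) ^ e * c ^ (Q - 1) by positivity)).eventually_ge_atTop B
  obtain ⟨X, hXB, hXX₀, hXR⟩ := (hlarge.and ((Filter.eventually_ge_atTop X₀).and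
    (Filter.eventually_ge_atTop R))).exists
  have hX0 : 0 < X := by linarith
  set M := c * X ^ (2 + q2 - Q) with hM
  have hM0 : 0 < M := by positivity
  have hMB : B ≤ c₃ * (1 / 4) ^ e * X ^ (3 + q2 - Q) * M ^ (Q - 1) := by
    refine hXB.trans (le_of_eq ?_)
    rw [hM, mul_rpow hc.le (by positivity), ← rpow_mul hX0.le,
      show 1 + (2 + q2 - Q) * Q = (3 + q2 - Q) + (2 + q2 - Q) * (Q - 1) by ring, rpow_add hX0]
    ring
  have key : ∀ k : ℕ, ∀ ξ ∈ Icc (X * (1 + (1 - (1 / 2) ^ k))) (2 * X),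
      ∀ ρ ∈ Icc (2 * X * (1 + (1 - (1 / 2) ^ k))) (4 * X), M * B ^ k ≤ v (ξ + ρ) ρ := by
    intro k
    induction k with
    | zero => simpa using hX₀ X hXX₀
    | succ k ih =>
      have hp : (0 : ℝ) < (1 / 2) ^ k := by positivity
      have hp1 : (1 / 2 : ℝ) ^ k ≤ 1 := pow_le_one₀ (by norm_num) (by norm_num)
      have hstep := h.lower_bound_step (d := (1 / 2) ^ k * (1 / 4)) hXR (sub_nonneg.2 hp1)
        (by positivity) (by linarith) (by positivity) ih
      rw [step_constant hX0 (by positivity) (by positivity)] at hstep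
      rw [show 1 - (1 / 2 : ℝ) ^ k + 2 * ((1 / 2) ^ k * (1 / 4)) = 1 - (1 / 2) ^ (k + 1) by
        ring] at hstep
      intro ξ hξ ρ hρ
      refine le_trans ?_ (hstep ξ hξ ρ hρ)
      have hBk : (B ^ k) ^ Q = B ^ k * (2 ^ e) ^ k := by
        rw [show Q = 1 + (Q - 1) by ring, rpow_add (by positivity), rpow_one, ← hBQ,
          rpow_pow_comm (by positivity)]
      have hMQ : M ^ Q = M * M ^ (Q - 1) := by
        rw [← rpow_one_add' hM0.le (by linarith)]
        congr 1
        ring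
      have hcancel : (((1 / 2 : ℝ) ^ k) ^ e) * (2 ^ e) ^ k = 1 := by
        rw [rpow_pow_comm (by norm_num), ← mul_rpow (by positivity) (by positivity), ← mul_pow]
        norm_num
      rw [mul_rpow hp.le (by norm_num), mul_rpow hM0.le (by positivity), hBk, hMQ]
      calc M * B ^ (k + 1) = M * B ^ k * B := by ring
        _ ≤ M * B ^ k * (c₃ * (1 / 4) ^ e * X ^ (3 + q2 - Q) * M ^ (Q - 1)) := by gcongr
        _ = M * B ^ k * (c₃ * (1 / 4) ^ e * X ^ (3 + q2 - Q) * M ^ (Q - 1))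
            * ((((1 / 2 : ℝ) ^ k) ^ e) * (2 ^ e) ^ k) := by rw [hcancel, mul_one]
        _ = _ := by ring
  obtain ⟨k, hk⟩ := pow_unbounded_of_one_lt (v (2 * X + 4 * X) (4 * X) / M) hB1
  rw [div_lt_iff₀ hM0] at hk
  have hp : (0 : ℝ) < (1 / 2) ^ k := by positivity
  have := key k (2 * X) ⟨by nlinarith, le_rfl⟩ (4 * X) ⟨by nlinarith, le_rfl⟩
  linarith

end RadialSystem

theorem IsWave.source_eq_zero {w wt wr F : ℝ → ℝ → ℝ} {R : ℝ} (h : IsWave (Ici 0) w wt wr F)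
    (hF : ∀ t r, 0 ≤ t → 0 ≤ r → 0 ≤ F t r)
    (hdata : ∀ r, R ≤ r → wt 0 r + wr 0 r = 0)
    (hray : ∀ ξ r, R ≤ ξ → 0 < r → wt (ξ + r) r + wr (ξ + r) r = 0)
    {s ρ : ℝ} (hs : 0 ≤ s) (hρ : 0 < ρ) (hsρ : R < s + ρ) : F s ρ = 0 := by
  refine le_antisymm (not_lt.1 fun hlt => ?_) (hF s ρ hs hρ.le)
  set r := min ρ (s + ρ - R) / 2 with hr
  have hr0 : 0 < r := half_pos (lt_min hρ (by linarith))
  have hr1 : 2 * r ≤ ρ := by linarith [min_le_left ρ (s + ρ - R)]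
  have hr2 : 2 * r ≤ s + ρ - R := by linarith [min_le_right ρ (s + ρ - R)]
  set t := s + ρ - r with ht
  have h1 := h.integral_le_add hF (t := t) (r := r) (hdata _ (by linarith)) (by linarith) hr0.le
    le_rfl (by linarith) le_rfl
  have h2 := hray (t - r) r (by linarith) hr0
  rw [sub_add_cancel] at h2
  have h4 : 0 < ∫ s in (0 : ℝ)..t, F s (t + r - s) :=
    intervalIntegral.integral_pos (by linarith) (h.continuous_inc _).continuousOn
      (fun x hx => hF x _ hx.1.le (by linarith [hx.2]))
      ⟨s, ⟨hs, by linarith⟩, by rwa [show t + r - s = ρ by rw [ht]; ring]⟩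
  linarith

theorem IsWave.ray_deriv_eq_zero {I : Set ℝ} {w wt wr F : ℝ → ℝ → ℝ} (h : IsWave I w wt wr F)
    {ξ : ℝ} (hw : ∀ r, 0 < r → w (ξ + r) r = 0) {r : ℝ} (hr : 0 < r) :
    wt (ξ + r) r + wr (ξ + r) r = 0 := by
  refine (h.hasDerivAt_ray ξ r).unique ((hasDerivAt_const r (0 : ℝ)).congr_of_eventuallyEq ?_)
  filter_upwards [lt_mem_nhds hr] with y hy using hw y hy

namespace RadialSystem

variable {q1 q2 R : ℝ} {u ut ur v vt vr F G : ℝ → ℝ → ℝ}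

theorem v_eq_zero_of_ray (h : RadialSystem q1 q2 R u ut ur v vt vr F G)
    (hsub : q1 * q2 * ((q2 - 2) + q2 * (q1 - 2)) < 1) {ξ r : ℝ} (hξ : R ≤ ξ) (hr : 0 < r) :
    v (ξ + r) r = 0 := by
  by_contra hne
  have hpos : 0 < v (ξ + r) r := (h.v_nonneg hξ hr.le).lt_of_ne' hne
  have hcont : Continuous fun y => v (y + r) r :=
    h.wave_v.cont.comp (f := fun y : ℝ => (y + r, r)) (by fun_prop)
  obtain ⟨δ, hδ, hball⟩ := Metric.eventually_nhds_iff.1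
    (hcont.continuousAt.eventually_const_lt (half_lt_self hpos))
  refine h.false_of_pos hsub hξ (show ξ < ξ + δ / 2 by linarith) hr (half_pos hpos)
    fun y hy => (hball ?_).le
  rw [Real.dist_eq, abs_lt]
  constructor <;> linarith [hy.1, hy.2]

theorem u_eq_zero_of_ray (h : RadialSystem q1 q2 R u ut ur v vt vr F G)
    (hsub : q1 * q2 * ((q2 - 2) + q2 * (q1 - 2)) < 1) {ξ r : ℝ} (hξ : R ≤ ξ) (hr : 0 < r) :
    u (ξ + r) r = 0 := by
  have hR := h.one_le_R
  have hq2 := h.one_lt_q2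
  by_contra hne
  have hpos : 0 < u (ξ + r) r := (h.u_nonneg hξ hr.le).lt_of_ne' hne
  have h1 := h.v_rate (t := ξ + r) hξ hr hr.le le_rfl (by ring)
  rw [h.wave_v.ray_deriv_eq_zero (fun y hy => h.v_eq_zero_of_ray hsub hξ hy) hr] at h1
  have h2 : 0 < r + ξ + R := by linarith
  have h3 : 0 < ξ + R := by linarith
  exact absurd h1 (not_le.2 (by positivity))

theorem v_eq_zero (h : RadialSystem q1 q2 R u ut ur v vt vr F G)
    (hsub : q1 * q2 * ((q2 - 2) + q2 * (q1 - 2)) < 1) {t r : ℝ} (ht : 0 ≤ t) (hr : 0 ≤ r)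
    (htr : R < t + r) : v t r = 0 := by
  rcases hr.eq_or_lt with rfl | hr
  · exact h.v_center t
  have h1 := h.wave_u.source_eq_zero h.F_nonneg h.u_data
    (fun ξ r hξ hr => h.wave_u.ray_deriv_eq_zero (fun y hy => h.u_eq_zero_of_ray hsub hξ hy) hr)
    ht hr htr
  rw [h.F_eq t r ht hr] at h1
  by_contra hne
  have := abs_pos.2 hne
  exact absurd h1 (by positivity)

theorem ut_eq_zero (h : RadialSystem q1 q2 R u ut ur v vt vr F G)
    (hsub : q1 * q2 * ((q2 - 2) + q2 * (q1 - 2)) < 1) {t r : ℝ} (ht : 0 ≤ t) (hr : 0 < r)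
    (htr : R < t + r) : ut t r = 0 := by
  have h1 := h.wave_v.source_eq_zero h.G_nonneg h.v_data
    (fun ξ r hξ hr => h.wave_v.ray_deriv_eq_zero (fun y hy => h.v_eq_zero_of_ray hsub hξ hy) hr)
    ht hr htr
  rw [h.G_eq t r ht hr] at h1
  by_contra hne
  have := abs_pos.2 hne
  exact absurd h1 (by positivity)

theorem u_eq_zero (h : RadialSystem q1 q2 R u ut ur v vt vr F G)
    (hsub : q1 * q2 * ((q2 - 2) + q2 * (q1 - 2)) < 1) {t r : ℝ} (ht : 0 ≤ t) (hr : 0 ≤ r)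
    (htr : R < t + r) : u t r = 0 := by
  have hR := h.one_le_R
  rcases hr.eq_or_lt with rfl | hr
  · exact h.u_center t
  have h1 := constant_of_has_deriv_right_zero (f := fun s => u s r) (a := t) (b := R + t + r)
    (fun s _ => (h.wave_u.time s r).continuousAt.continuousWithinAt) fun s hs => by
      have := h.wave_u.time s r
      rw [h.ut_eq_zero hsub (ht.trans hs.1) hr (by linarith [hs.1])] at this
      exact this.hasDerivWithinAt
  rw [← h1 (R + t + r) ⟨by linarith, le_rfl⟩]
  exact h.u_eq_zero_of_ray hsub (by linarith) hr

end RadialSystem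

theorem IsWave.of_contDiff {w F : ℝ → ℝ → ℝ} (hw : ContDiff ℝ 2 (Function.uncurry w))
    (hF : Continuous (Function.uncurry F))
    (heq : ∀ t r, 0 ≤ t →
      deriv (fun s => deriv (fun s' => w s' r) s) t - deriv (fun x => deriv (w t) x) r = F t r) :
    IsWave (Ici 0) w (fun t r => deriv (fun s => w s r) t) (fun t r => deriv (w t) r) F := by
  set W := Function.uncurry w with hW
  have hD : ∀ p, HasFDerivAt W (fderiv ℝ W p) p := fun p =>
    (hw.differentiable (by norm_num)).differentiableAt.hasFDerivAt
  have hD1 : ContDiff ℝ 1 (fderiv ℝ W) := hw.fderiv_right (by norm_num)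
  have hD2 : ∀ p v, HasFDerivAt (fun p => fderiv ℝ W p v)
      ((ContinuousLinearMap.apply ℝ ℝ v).comp (fderiv ℝ (fderiv ℝ W) p)) p := fun p v =>
    (ContinuousLinearMap.apply ℝ ℝ v).hasFDerivAt.comp p
      (hD1.differentiable (by norm_num)).differentiableAt.hasFDerivAt
  have hsymm : ∀ p x y, fderiv ℝ (fderiv ℝ W) p x y = fderiv ℝ (fderiv ℝ W) p y x := fun p =>
    hw.contDiffAt.isSymmSndFDerivAt (by simp)
  have line_t : ∀ (s r : ℝ), HasDerivAt (fun s : ℝ => (s, r)) ((1 : ℝ), (0 : ℝ)) s := fun s r =>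
    (hasDerivAt_id' s).prodMk (hasDerivAt_const s r)
  have line_r : ∀ (s r : ℝ), HasDerivAt (fun r : ℝ => (s, r)) ((0 : ℝ), (1 : ℝ)) r := fun s r =>
    (hasDerivAt_const r s).prodMk (hasDerivAt_id' r)
  have line_out : ∀ (c s : ℝ),
      HasDerivAt (fun s : ℝ => (s, s + c)) (((1 : ℝ), (0 : ℝ)) + ((0 : ℝ), (1 : ℝ))) s := fun c s =>
    ((hasDerivAt_id' s).prodMk ((hasDerivAt_id' s).add_const c)).congr_deriv (by simp)
  have line_inc : ∀ (c s : ℝ),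
      HasDerivAt (fun s : ℝ => (s, c - s)) (((1 : ℝ), (0 : ℝ)) - ((0 : ℝ), (1 : ℝ))) s := fun c s =>
    ((hasDerivAt_id' s).prodMk ((hasDerivAt_id' s).const_sub c)).congr_deriv (by simp)
  have ht : ∀ s r, HasDerivAt (fun s => w s r) (fderiv ℝ W (s, r) (1, 0)) s := fun s r =>
    HasFDerivAt.comp_hasDerivAt (l := W) s (hD (s, r)) (line_t s r)
  have hr : ∀ s r, HasDerivAt (fun r => w s r) (fderiv ℝ W (s, r) (0, 1)) r := fun s r =>
    HasFDerivAt.comp_hasDerivAt (l := W) r (hD (s, r)) (line_r s r)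
  have et : (fun t r => deriv (fun s => w s r) t) = fun t r => fderiv ℝ W (t, r) (1, 0) :=
    funext₂ fun t r => (ht t r).deriv
  have er : (fun t r => deriv (w t) r) = fun t r => fderiv ℝ W (t, r) (0, 1) :=
    funext₂ fun t r => (hr t r).deriv
  have heq' : ∀ t r, 0 ≤ t → fderiv ℝ (fderiv ℝ W) (t, r) (1, 0) (1, 0)
      - fderiv ℝ (fderiv ℝ W) (t, r) (0, 1) (0, 1) = F t r := by
    intro t r htn
    rw [← heq t r htn]
    congr 1
    · rw [show (fun s => deriv (fun s' => w s' r) s) = fun s => fderiv ℝ W (s, r) (1, 0) from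
        funext fun s => congrFun₂ et s r]
      exact ((hD2 (t, r) (1, 0)).comp_hasDerivAt t (line_t t r)).deriv.symm
    · rw [show (fun x => deriv (w t) x) = fun x => fderiv ℝ W (t, x) (0, 1) from congrFun er t]
      exact ((hD2 (t, r) (0, 1)).comp_hasDerivAt r (line_r t r)).deriv.symm
  rw [et, er]
  refine ⟨hw.continuous, ?_, ?_, hF, ht, hr, fun c s => ?_, fun c s => ?_, fun c s hs => ?_,
    fun c s hs => ?_⟩
  · exact hD1.continuous.clm_apply continuous_const
  · exact hD1.continuous.clm_apply continuous_const
  · exact ((hD (s, s + c)).comp_hasDerivAt s (line_out c s)).congr_deriv (map_add _ _ _)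
  · exact ((hD (s, c - s)).comp_hasDerivAt s (line_inc c s)).congr_deriv (map_sub _ _ _)
  · refine (((hD2 (s, s + c) (1, 0)).comp_hasDerivAt s (line_out c s)).sub
      ((hD2 (s, s + c) (0, 1)).comp_hasDerivAt s (line_out c s))).congr_deriv ?_
    rw [← heq' s _ hs, map_add, map_add]
    simp only [ContinuousLinearMap.comp_apply, ContinuousLinearMap.apply_apply]
    rw [hsymm _ (0, 1) (1, 0)]
    ring
  · refine (((hD2 (s, c - s) (1, 0)).comp_hasDerivAt s (line_inc c s)).add
      ((hD2 (s, c - s) (0, 1)).comp_hasDerivAt s (line_inc c s))).congr_deriv ?_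
    rw [← heq' s _ hs, map_sub, map_sub]
    simp only [ContinuousLinearMap.comp_apply, ContinuousLinearMap.apply_apply]
    rw [hsymm _ (0, 1) (1, 0)]
    ring

theorem Radial.deriv_axis_neg {f : E3 → ℝ} (hf : Radial f) (r : ℝ) :
    deriv (fun r : ℝ => f (r • EuclideanSpace.single 0 1)) (-r) =
      -deriv (fun r : ℝ => f (r • EuclideanSpace.single 0 1)) r := by
  have h := deriv_comp_neg (fun r : ℝ => f (r • EuclideanSpace.single 0 1)) r
  rw [show (fun x : ℝ => f (-x • EuclideanSpace.single 0 1)) =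
    fun x : ℝ => f (x • EuclideanSpace.single 0 1) from funext fun x => hf _ _ (by simp)] at h
  linarith

theorem pX_pX_axis_zero (f : E3 → ℝ) (r : ℝ) :
    pX 0 (pX 0 f) (r • EuclideanSpace.single 0 1) =
      deriv (fun x => deriv (fun r : ℝ => f (r • EuclideanSpace.single 0 1)) x) r := by
  have h1 : ∀ ρ : ℝ, pX 0 f (ρ • EuclideanSpace.single 0 1) =
      deriv (fun r : ℝ => f (r • EuclideanSpace.single 0 1)) ρ := fun ρ => by
    simp only [pX, ← add_smul]
    rw [deriv_comp_const_add (fun r : ℝ => f (r • EuclideanSpace.single 0 1)), add_zero]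
  conv_lhs => rw [pX]
  simp only [← add_smul, h1]
  rw [deriv_comp_const_add (fun x => deriv (fun r : ℝ => f (r • EuclideanSpace.single 0 1)) x),
    add_zero]

theorem pX_pX_axis_of_ne_zero {f : E3 → ℝ} (hf : ContDiff ℝ 2 f) (hrad : Radial f) {i : Fin 3}
    (hi : i ≠ 0) {r : ℝ} (hr : r ≠ 0) :
    pX i (pX i f) (r • EuclideanSpace.single 0 1) =
      deriv (fun r : ℝ => f (r • EuclideanSpace.single 0 1)) r / r := by
  set g := fun r : ℝ => f (r • EuclideanSpace.single 0 1) with hg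
  have hg2 : ContDiff ℝ 2 g := hf.comp (by fun_prop)
  have hg1 : ContDiff ℝ 1 (deriv g) := (contDiff_succ_iff_deriv.1 hg2).2.2
  have hpos : ∀ k : ℝ, 0 < r ^ 2 + k ^ 2 := fun k => by positivity
  have hsq : ∀ k : ℝ, f (r • EuclideanSpace.single 0 1 + k • EuclideanSpace.single i 1) =
      g (√(r ^ 2 + k ^ 2)) := fun k => by
    refine hrad _ _ ?_
    rw [norm_smul, PiLp.norm_single, EuclideanSpace.norm_eq, Fin.sum_univ_three]
    have : √(r ^ 2 + k ^ 2) = ‖√(r ^ 2 + k ^ 2)‖ * ‖(1 : ℝ)‖ := by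
      simp [abs_of_nonneg (Real.sqrt_nonneg _)]
    rw [← this]
    congr 1
    fin_cases i <;> simp at hi ⊢
  have hroot : ∀ k : ℝ, HasDerivAt (fun k : ℝ => √(r ^ 2 + k ^ 2)) (k / √(r ^ 2 + k ^ 2)) k :=
    fun k => (((hasDerivAt_pow 2 k).const_add (r ^ 2)).sqrt (hpos k).ne').congr_deriv (by
      have := (Real.sqrt_pos.2 (hpos k)).ne'
      simp only [Nat.cast_ofNat, Nat.add_one_sub_one, pow_one]
      field_simp)
  have h1 : ∀ h : ℝ, pX i f (r • EuclideanSpace.single 0 1 + h • EuclideanSpace.single i 1) =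
      h * (deriv g (√(r ^ 2 + h ^ 2)) / √(r ^ 2 + h ^ 2)) := fun h => by
    simp only [pX, add_assoc, ← add_smul, hsq]
    rw [deriv_comp_const_add (fun k : ℝ => g (√(r ^ 2 + k ^ 2))), add_zero]
    have hgd := (hg2.differentiable (by norm_num) (√(r ^ 2 + h ^ 2))).hasDerivAt
    refine (hgd.comp h (hroot h)).deriv.trans ?_
    ring
  have hm : DifferentiableAt ℝ (fun h : ℝ => deriv g (√(r ^ 2 + h ^ 2)) / √(r ^ 2 + h ^ 2)) 0 :=
    ((hg1.differentiable (by norm_num) _).comp 0 (hroot 0).differentiableAt).div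
      (hroot 0).differentiableAt (Real.sqrt_pos.2 (hpos 0)).ne'
  conv_lhs => rw [pX]
  simp only [h1]
  refine ((hasDerivAt_id' 0).mul hm.hasDerivAt).deriv.trans ?_
  simp only [ne_eq, OfNat.ofNat_ne_zero, not_false_eq_true, zero_pow, add_zero, one_mul, zero_mul,
    Real.sqrt_sq_eq_abs]
  rcases abs_choice r with h | h <;> rw [h]
  rw [hrad.deriv_axis_neg, neg_div_neg_eq]

theorem mul_lap3_axis {f : E3 → ℝ} (hf : ContDiff ℝ 2 f) (hrad : Radial f) (r : ℝ) :
    r * lap3 f (r • EuclideanSpace.single 0 1) =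
      deriv (fun x => deriv (fun r : ℝ => r * f (r • EuclideanSpace.single 0 1)) x) r := by
  set g := fun r : ℝ => f (r • EuclideanSpace.single 0 1) with hg
  have hg2 : ContDiff ℝ 2 g := hf.comp (by fun_prop)
  have hg1 : ContDiff ℝ 1 (deriv g) := (contDiff_succ_iff_deriv.1 hg2).2.2
  have h1 : ∀ x, HasDerivAt g (deriv g x) x := fun x =>
    (hg2.differentiable (by norm_num) x).hasDerivAt
  have h2 : ∀ x, HasDerivAt (deriv g) (deriv (deriv g) x) x := fun x =>
    (hg1.differentiable (by norm_num) x).hasDerivAt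
  have h3 : deriv (fun x => deriv (fun r : ℝ => r * g r) x) r =
      2 * deriv g r + r * deriv (deriv g) r := by
    rw [show (fun x => deriv (fun r : ℝ => r * g r) x) = fun x => 1 * g x + x * deriv g x from
      funext fun x => ((hasDerivAt_id' x).mul (h1 x)).deriv]
    refine (((h1 r).const_mul 1).add ((hasDerivAt_id' r).mul (h2 r))).deriv.trans ?_
    ring
  change _ = deriv (fun x => deriv (fun r : ℝ => r * g r) x) r
  rw [h3]
  rcases eq_or_ne r 0 with rfl | hr
  · have := hrad.deriv_axis_neg 0
    rw [neg_zero] at this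
    have h0 : deriv g 0 = 0 := by linarith
    simp [h0]
  · rw [lap3, Fin.sum_univ_three, pX_pX_axis_zero, pX_pX_axis_of_ne_zero hf hrad (by decide) hr,
      pX_pX_axis_of_ne_zero hf hrad (by decide) hr]
    change r * (deriv (deriv g) r + deriv g r / r + deriv g r / r) = _
    field_simp
    ring

theorem continuous_dtP {φ : ℝ → E3 → ℝ} (hφ : ContDiff ℝ 2 (fun p : ℝ × E3 => φ p.1 p.2)) :
    Continuous fun p : ℝ × E3 => dtP φ p.1 p.2 := by
  have h1 : ∀ p : ℝ × E3, dtP φ p.1 p.2 = fderiv ℝ (fun p : ℝ × E3 => φ p.1 p.2) p (1, 0) :=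
    fun p => (HasFDerivAt.comp_hasDerivAt (l := fun p : ℝ × E3 => φ p.1 p.2) p.1
      (hφ.differentiable (by norm_num) p).hasFDerivAt
      ((hasDerivAt_id' p.1).prodMk (hasDerivAt_const p.1 p.2))).deriv
  simp only [h1]
  exact (hφ.continuous_fderiv (by norm_num)).clm_apply continuous_const

theorem Radial.dtP {φ : ℝ → E3 → ℝ} (h : ∀ t, Radial (φ t)) (t : ℝ) : Radial (dtP φ t) :=
  fun x y hxy => by simp only [_root_.dtP, fun s => h s x y hxy]

/-- A radial solution of `□φ = H` gives, after multiplication by `r`, a solution of the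
one-dimensional wave equation. -/
theorem isWave_of_box_eq {φ H : ℝ → E3 → ℝ} (hφ : ContDiff ℝ 2 (fun p : ℝ × E3 => φ p.1 p.2))
    (hrad : ∀ t, Radial (φ t)) (hH : Continuous fun p : ℝ × E3 => H p.1 p.2)
    (heq : ∀ t x, 0 ≤ t → box φ t x = H t x) :
    IsWave (Ici 0) (fun t r => r * φ t (r • EuclideanSpace.single 0 1))
      (fun t r => r * dtP φ t (r • EuclideanSpace.single 0 1))
      (fun t r => deriv (fun r => r * φ t (r • EuclideanSpace.single 0 1)) r)
      (fun t r => r * H t (r • EuclideanSpace.single 0 1)) := by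
  have ht : ∀ t r : ℝ, deriv (fun s => r * φ s (r • EuclideanSpace.single 0 1)) t =
      r * dtP φ t (r • EuclideanSpace.single 0 1) := fun t r => deriv_const_mul_field _
  have hmap : ContDiff ℝ 2 fun p : ℝ × ℝ => (p.1, p.2 • (EuclideanSpace.single 0 1 : E3)) := by
    fun_prop
  have h := IsWave.of_contDiff (w := fun t r => r * φ t (r • EuclideanSpace.single 0 1))
    (F := fun t r => r * H t (r • EuclideanSpace.single 0 1))
    (contDiff_snd.mul (hφ.comp hmap)) (continuous_snd.mul (hH.comp hmap.continuous))
    fun t r htn => by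
      rw [← heq t _ htn, box, mul_sub, mul_lap3_axis (f := φ t) (hφ.comp
        (contDiff_const.prodMk contDiff_id)) (hrad t)]
      simp only [ht]
      rw [deriv_const_mul_field]
      rfl
  simpa only [ht] using h

theorem exists_forall_le_abs_axis_eq_zero {φ : ℝ → E3 → ℝ} (h : HasCompactSupport (φ 0))
    (h' : HasCompactSupport (fun x : E3 => dtP φ 0 x)) :
    ∃ R : ℝ, ∀ r, R ≤ |r| → r * φ 0 (r • EuclideanSpace.single 0 1) = 0 ∧
      r * dtP φ 0 (r • EuclideanSpace.single 0 1) = 0 ∧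
      deriv (fun r => r * φ 0 (r • EuclideanSpace.single 0 1)) r = 0 := by
  obtain ⟨A, -, hA⟩ := h.exists_pos_le_norm
  obtain ⟨B, -, hB⟩ := h'.exists_pos_le_norm
  have hn : ∀ r : ℝ, ‖r • (EuclideanSpace.single 0 1 : E3)‖ = |r| := fun r => by simp [norm_smul]
  refine ⟨max (A + 1) B, fun r hr => ⟨?_, ?_, ?_⟩⟩
  · rw [hA _ (by rw [hn]; linarith [le_max_left (A + 1) B]), mul_zero]
  · rw [hB _ (by rw [hn]; linarith [le_max_right (A + 1) B]), mul_zero]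
  · have hev : (fun r : ℝ => r * φ 0 (r • EuclideanSpace.single 0 1)) =ᶠ[nhds r] fun _ => 0 := by
      have : ∀ᶠ x : ℝ in nhds r, A < |x| :=
        continuous_abs.continuousAt.eventually_const_lt (by linarith [le_max_left (A + 1) B])
      filter_upwards [this] with x hx
      rw [hA _ (by rw [hn]; exact hx.le), mul_zero]
    rw [hev.deriv_eq, deriv_const]

theorem Radial.eq_zero_of_axis {f : E3 → ℝ} (hrad : Radial f) (hf : Continuous f)
    (h : ∀ r : ℝ, r * f (r • EuclideanSpace.single 0 1) = 0) (x : E3) : f x = 0 := by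
  have h1 : (fun r : ℝ => f (r • EuclideanSpace.single 0 1)) = fun _ => 0 :=
    Continuous.ext_on (dense_compl_singleton 0) (by fun_prop) continuous_const
      fun r hr => (mul_eq_zero.1 (h r)).resolve_left hr
  rw [hrad x (‖x‖ • EuclideanSpace.single 0 1) (by simp [norm_smul])]
  exact congrFun h1 ‖x‖

theorem exists_abs_mul_rpow_le {H : ℝ → ℝ → ℝ} (hH : Continuous (Function.uncurry H)) {q : ℝ}
    (hq : 1 < q) (T a b : ℝ) : ∃ K, 0 ≤ K ∧ ∀ s ∈ Icc 0 T, ∀ r ∈ Icc a b,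
      |r * |H s r| ^ q| ≤ K * |r * H s r| := by
  obtain ⟨M, hM⟩ := (isCompact_Icc.prod isCompact_Icc : IsCompact (Icc 0 T ×ˢ Icc a b))
    |>.exists_bound_of_continuousOn hH.continuousOn
  refine ⟨max M 0 ^ (q - 1), by positivity, fun s hs r hr => ?_⟩
  have h1 : |H s r| ≤ max M 0 := (hM (s, r) ⟨hs, hr⟩).trans (le_max_left _ _)
  rw [abs_mul, abs_mul, abs_of_nonneg (by positivity : 0 ≤ |H s r| ^ q)]
  have h2 : |H s r| ^ q = |H s r| ^ (q - 1) * |H s r| := by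
    conv_rhs => rw [← Real.rpow_one |H s r|]
    rw [Real.rpow_one, ← Real.rpow_add_one' (abs_nonneg _) (by linarith), sub_add_cancel]
  rw [h2, mul_left_comm]
  exact mul_le_mul_of_nonneg_right (Real.rpow_le_rpow (abs_nonneg _) h1 (by linarith))
    (by positivity)

theorem mul_rpow_eq_rpow_mul {r : ℝ} (hr : 0 < r) (y q : ℝ) :
    r * |y| ^ q = r ^ (1 - q) * |r * y| ^ q := by
  rw [abs_mul, abs_of_pos hr, Real.mul_rpow hr.le (abs_nonneg y), ← mul_assoc,
    ← Real.rpow_add hr, sub_add_cancel, Real.rpow_one]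

theorem IsWave.eq_zero_of_eventually {I : Set ℝ} {w wt wr F : ℝ → ℝ → ℝ}
    (h : IsWave I w wt wr F) {T : ℝ} (hw : ∀ᶠ t in nhds T, ∀ r, w t r = 0) (r : ℝ) :
    w T r = 0 ∧ wt T r = 0 ∧ wr T r = 0 := by
  refine ⟨hw.self_of_nhds r, ?_, ?_⟩
  · refine (h.time T r).unique ((hasDerivAt_const T (0 : ℝ)).congr_of_eventuallyEq ?_)
    filter_upwards [hw] with t ht using ht r
  · exact (h.space T r).unique ((hasDerivAt_const r (0 : ℝ)).congr_of_eventuallyEq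
      (Filter.Eventually.of_forall hw.self_of_nhds))

theorem data_eq_zero_of_global_solution {q1 q2 : ℝ} (hq1 : 1 < q1) (hq2 : 1 < q2)
    (hsub : q1 * q2 * ((q2 - 2) + q2 * (q1 - 2)) < 1) {φ1 φ2 : ℝ → E3 → ℝ}
    (hc1 : ContDiff ℝ 2 (fun p : ℝ × E3 => φ1 p.1 p.2))
    (hc2 : ContDiff ℝ 2 (fun p : ℝ × E3 => φ2 p.1 p.2))
    (hr1 : ∀ t, Radial (φ1 t)) (hr2 : ∀ t, Radial (φ2 t))
    (he1 : ∀ (t : ℝ) (x : E3), 0 ≤ t → box φ1 t x = |φ2 t x| ^ q1)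
    (he2 : ∀ (t : ℝ) (x : E3), 0 ≤ t → box φ2 t x = |dtP φ1 t x| ^ q2)
    (hs1 : HasCompactSupport (φ1 0)) (hs1' : HasCompactSupport (fun x : E3 => dtP φ1 0 x))
    (hs2 : HasCompactSupport (φ2 0)) (hs2' : HasCompactSupport (fun x : E3 => dtP φ2 0 x))
    (x : E3) : φ1 0 x = 0 ∧ dtP φ1 0 x = 0 ∧ φ2 0 x = 0 ∧ dtP φ2 0 x = 0 := by
  set e : E3 := EuclideanSpace.single 0 1
  have hd1 := continuous_dtP hc1
  have hd2 := continuous_dtP hc2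
  have waveU := isWave_of_box_eq hc1 hr1
    (hc2.continuous.abs.rpow_const fun _ => Or.inr (by linarith)) he1
  have waveV := isWave_of_box_eq hc2 hr2
    (hd1.abs.rpow_const fun _ => Or.inr (by linarith)) he2
  have hline : Continuous fun p : ℝ × ℝ => (p.1, p.2 • e) := by fun_prop
  have boundF := exists_abs_mul_rpow_le (H := fun t r => φ2 t (r • e))
    (hc2.continuous.comp hline) hq1
  have boundG := exists_abs_mul_rpow_le (H := fun t r => dtP φ1 t (r • e))
    (hd1.comp hline) hq2
  obtain ⟨A, hA⟩ := exists_forall_le_abs_axis_eq_zero hs1 hs1'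
  obtain ⟨B, hB⟩ := exists_forall_le_abs_axis_eq_zero hs2 hs2'
  obtain ⟨R, hR1, hRA, hRB⟩ : ∃ R, 1 ≤ R ∧ A ≤ R ∧ B ≤ R :=
    ⟨max 1 (max A B), le_max_left _ _, (le_max_left _ _).trans (le_max_right _ _),
      (le_max_right _ _).trans (le_max_right _ _)⟩
  have sys : RadialSystem q1 q2 R _ _ _ _ _ _ _ _ :=
    { wave_u := waveU
      wave_v := waveV
      one_lt_q1 := hq1
      one_lt_q2 := hq2
      one_le_R := hR1
      u_center := fun t => zero_mul _
      v_center := fun t => zero_mul _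
      F_center := fun t => zero_mul _
      G_center := fun t => zero_mul _
      F_eq := fun t r _ hr => mul_rpow_eq_rpow_mul hr _ _
      G_eq := fun t r _ hr => mul_rpow_eq_rpow_mul hr _ _
      u_data := fun r hr => by
        have h := hA r (by linarith [le_abs_self r])
        rw [h.2.1, h.2.2, add_zero]
      v_data := fun r hr => by
        have h := hB r (by linarith [le_abs_self r])
        rw [h.2.1, h.2.2, add_zero]
      u_out := fun t r ht hr => by
        obtain ⟨K, hK, hKF⟩ := boundF t (r - t) (r + t)
        obtain ⟨L, hL, hLG⟩ := boundG t (r - t) (r + t)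
        refine ((waveU.mono Icc_subset_Ici_self).eq_zero_of_triangle (K := K + L)
          (waveV.mono Icc_subset_Ici_self) ht (by positivity) (fun s hs ρ hρ => ?_)
          (fun s hs ρ hρ => ?_) (fun ρ hρ => ?_) fun ρ hρ => ?_).1
        · have := abs_le.1 hρ
          exact (hKF s hs ρ ⟨by linarith [hs.1], by linarith [hs.1]⟩).trans (by gcongr; linarith)
        · have := abs_le.1 hρ
          exact (hLG s hs ρ ⟨by linarith [hs.1], by linarith [hs.1]⟩).trans (by gcongr; linarith)
        · exact hA ρ (by linarith [le_abs_self ρ, (abs_le.1 hρ).1])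
        · exact hB ρ (by linarith [le_abs_self ρ, (abs_le.1 hρ).1]) }
  have hlt : ∀ᶠ t in nhds (R + 1), R < t := lt_mem_nhds (by linarith)
  have endU := waveU.eq_zero_of_eventually (T := R + 1) <| hlt.mono fun t ht r => by
    have h := sys.u_eq_zero hsub (t := t) (r := |r|) (by linarith) (abs_nonneg r)
      (by linarith [abs_nonneg r])
    rw [hr1 t (r • e) (|r| • e) (by simp [norm_smul])]
    rcases abs_choice r with hr | hr <;> rw [hr] at h ⊢ <;> linarith
  have endV := waveV.eq_zero_of_eventually (T := R + 1) <| hlt.mono fun t ht r => by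
    have h := sys.v_eq_zero hsub (t := t) (r := |r|) (by linarith) (abs_nonneg r)
      (by linarith [abs_nonneg r])
    rw [hr2 t (r • e) (|r| • e) (by simp [norm_smul])]
    rcases abs_choice r with hr | hr <;> rw [hr] at h ⊢ <;> linarith
  have start : ∀ r : ℝ, r * φ1 0 (r • e) = 0 ∧ -(r * dtP φ1 0 (r • e)) = 0 ∧
      r * φ2 0 (r • e) = 0 ∧ -(r * dtP φ2 0 (r • e)) = 0 := fun r => by
    obtain ⟨K, hK, hKF⟩ := boundF (R + 1) (r - (R + 1)) (r + (R + 1))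
    obtain ⟨L, hL, hLG⟩ := boundG (R + 1) (r - (R + 1)) (r + (R + 1))
    have h := (waveU.mono Icc_subset_Ici_self).reverse.eq_zero_of_triangle (K := K + L)
      (r₀ := r) (waveV.mono Icc_subset_Ici_self).reverse (T := R + 1) (by linarith)
      (by positivity)
      (fun s hs ρ hρ => by
        have := abs_le.1 hρ
        exact (hKF _ ⟨by linarith [hs.2], by linarith [hs.1]⟩ ρ
          ⟨by linarith [hs.1], by linarith [hs.1]⟩).trans (by gcongr; linarith))
      (fun s hs ρ hρ => by
        have := abs_le.1 hρ
        rw [abs_neg]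
        exact (hLG _ ⟨by linarith [hs.2], by linarith [hs.1]⟩ ρ
          ⟨by linarith [hs.1], by linarith [hs.1]⟩).trans (by gcongr; linarith))
      (fun ρ _ => by simpa only [sub_zero, neg_eq_zero] using endU ρ)
      (fun ρ _ => by simpa only [sub_zero, neg_eq_zero] using endV ρ)
    simpa only [sub_self] using h
  refine ⟨(hr1 0).eq_zero_of_axis ?_ (fun r => (start r).1) x,
    (Radial.dtP hr1 0).eq_zero_of_axis ?_ (fun r => neg_eq_zero.1 (start r).2.1) x,
    (hr2 0).eq_zero_of_axis ?_ (fun r => (start r).2.2.1) x,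
    (Radial.dtP hr2 0).eq_zero_of_axis ?_ (fun r => neg_eq_zero.1 (start r).2.2.2) x⟩
  · exact hc1.continuous.comp (f := fun x : E3 => ((0 : ℝ), x)) (by fun_prop)
  · exact hd1.comp (f := fun x : E3 => ((0 : ℝ), x)) (by fun_prop)
  · exact hc2.continuous.comp (f := fun x : E3 => ((0 : ℝ), x)) (by fun_prop)
  · exact hd2.comp (f := fun x : E3 => ((0 : ℝ), x)) (by fun_prop)

/-- Blow-up for the Glassey–Strauss system below the critical curve: for `q₁, q₂ > 1`,
`q₁ < 2`, `q₁q₂((q₂-2)+q₂(q₁-2)) < 1`, the system `□φ₁ = |φ₂|^{q₁}`, `□φ₂ = |∂_tφ₁|^{q₂}`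
admits no global spherically symmetric `C²` solution on `[0,∞) × ℝ³` with compactly
supported, not identically vanishing initial data. -/
theorem stmt_12 (q1 q2 : ℝ) (hq1 : 1 < q1) (hq2 : 1 < q2) (hq1' : q1 < 2)
    (hsub : q1 * q2 * ((q2 - 2) + q2 * (q1 - 2)) < 1) :
    ¬ ∃ φ1 φ2 : ℝ → E3 → ℝ,
      ContDiff ℝ 2 (fun p : ℝ × E3 => φ1 p.1 p.2) ∧
      ContDiff ℝ 2 (fun p : ℝ × E3 => φ2 p.1 p.2) ∧
      (∀ t, Radial (φ1 t)) ∧ (∀ t, Radial (φ2 t)) ∧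
      (∀ (t : ℝ) (x : E3), 0 ≤ t → box φ1 t x = |φ2 t x| ^ q1) ∧
      (∀ (t : ℝ) (x : E3), 0 ≤ t → box φ2 t x = |dtP φ1 t x| ^ q2) ∧
      HasCompactSupport (φ1 0) ∧ HasCompactSupport (fun x : E3 => dtP φ1 0 x) ∧
      HasCompactSupport (φ2 0) ∧ HasCompactSupport (fun x : E3 => dtP φ2 0 x) ∧
      ¬ (∀ x : E3, φ1 0 x = 0 ∧ dtP φ1 0 x = 0 ∧ φ2 0 x = 0 ∧ dtP φ2 0 x = 0) := by
  rintro ⟨φ1, φ2, hc1, hc2, hr1, hr2, he1, he2, hs1, hs1', hs2, hs2', hne⟩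
  exact hne (data_eq_zero_of_global_solution hq1 hq2 hsub hc1 hc2 hr1 hr2 he1 he2 hs1 hs1' hs2 hs2')

end
end
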